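/- Consider the random matching model: for even n and integer d ≥ 3, choose d independent uniformly random perfect matchings M_1,…,M_d of {1,…,n} and let G be the multigraph on {1,…,n} whose multiplicity between i ≠ i' is the number of indices k with {i,i'} ∈ M_k. Let (d_n) be a sequence of integers with d_n ≥ 3 and d_n/√n → 0. If all d_n are odd, then as n → ∞ over even n, E_{G,θ}[m₂(G,θ)] → 2; if all d_n are even, then E_{G,θ}[m₂(G,θ)] → 3. Here E_{G,θ} denotes the average over the d_n independent uniformly random perfect matchings and the uniform average (2π)^{-n} ∫_{[0,2π]^n} dθ over angles. -/

import Mathlib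

open scoped BigOperators
open MeasureTheory

noncomputable section

/-- The amplitude `2^{-n} Σ_z (−1)^{Σ_{i<j} m_{ij} z_i z_j + Σ_i x_i z_i}
Π_j exp(−i θ_j (−1)^{z_j})` of measuring the graph state of the multigraph with edge
multiplicities `m` in the X-Y plane product basis with angles `θ`, at outcome `x`. -/
def gsAmp (n : ℕ) (m : Fin n → Fin n → ℕ) (θ : Fin n → ℝ) (x : Fin n → Bool) : ℂ :=
  (1 / 2 ^ n : ℂ) * ∑ z : Fin n → Bool,
    (-1 : ℂ) ^ ((∑ i : Fin n, ∑ j : Fin n, if i < j ∧ z i ∧ z j then m i j else 0) +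
        ∑ i : Fin n, (if x i ∧ z i then 1 else 0)) *
      ∏ j : Fin n, Complex.exp (-Complex.I * (θ j : ℂ) * (-1 : ℂ) ^ (if z j then 1 else 0))

/-- The output probability `p_{G,θ}(x)`. -/
def gsProb (n : ℕ) (m : Fin n → Fin n → ℕ) (θ : Fin n → ℝ) (x : Fin n → Bool) : ℝ :=
  Complex.normSq (gsAmp n m θ x)

/-- The normalized second moment `m₂(G,θ) = 2^n Σ_x p_{G,θ}(x)²`. -/
def secondMoment (n : ℕ) (m : Fin n → Fin n → ℕ) (θ : Fin n → ℝ) : ℝ :=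
  2 ^ n * ∑ x : Fin n → Bool, (gsProb n m θ x) ^ 2

/-- The uniform average `(2π)^{-n} ∫_{[0,2π]^n} m₂(G,θ) dθ` over measurement angles. -/
def avgSecondMoment (n : ℕ) (m : Fin n → Fin n → ℕ) : ℝ :=
  ((2 * Real.pi) ^ n)⁻¹ *
    ∫ θ in Set.univ.pi (fun _ : Fin n => Set.Icc (0 : ℝ) (2 * Real.pi)), secondMoment n m θ

/-- The perfect matchings of a finite set `V`, encoded as fixed-point-free involutions. -/
def perfectMatchings (V : Type*) [Fintype V] [DecidableEq V] : Finset (Equiv.Perm V) :=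
  Finset.univ.filter fun σ => (∀ v, σ (σ v) = v) ∧ ∀ v, σ v ≠ v

/-- The multigraph of the matching model built from `d` perfect matchings `f 1, …, f d` of
`{1,…,n}`: the multiplicity between `i ≠ i'` is the number of `k` with `{i,i'} ∈ M_k`. -/
def matchingMult (n d : ℕ) (f : Fin d → Equiv.Perm (Fin n)) : Fin n → Fin n → ℕ :=
  fun i i' => (Finset.univ.filter fun k : Fin d => f k i = i').card

/-- `E_{G,θ}[m₂(G,θ)]` for the random matching model: the average over `d` independent
uniformly random perfect matchings of `{1,…,n}` and the uniform angle average. -/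
def matchingAvgM2 (n d : ℕ) : ℝ :=
  (∑ f ∈ Fintype.piFinset (fun _ : Fin d => perfectMatchings (Fin n)),
      avgSecondMoment n (matchingMult n d f)) /
    (((perfectMatchings (Fin n)).card : ℝ) ^ d)

/-- The sign `∏_{i<j, z i, z j} (-1)^{m i j}` of a bit string. -/
def quadSign {n : ℕ} (m : Fin n → Fin n → ℕ) (z : Fin n → Bool) : ℝ :=
  ∏ i, ∏ j, if i < j ∧ z i ∧ z j then (-1) ^ m i j else 1

/-- The local factor of an amplitude at a vertex with outcome `x`, angle `t` and bit `b`. -/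
def localPhase (x : Bool) (t : ℝ) (b : Bool) : ℂ :=
  (if x ∧ b then -1 else 1) * Complex.exp (-Complex.I * (t : ℂ) * (-1 : ℂ) ^ (if b then 1 else 0))

lemma gsAmp_eq_sum_quadSign (n : ℕ) (m : Fin n → Fin n → ℕ) (θ : Fin n → ℝ) (x : Fin n → Bool) :
    gsAmp n m θ x = (1 / 2 ^ n : ℂ) * ∑ z : Fin n → Bool,
      (quadSign m z : ℂ) * ∏ j, localPhase (x j) (θ j) (z j) := by
  unfold gsAmp quadSign localPhase
  congr 1
  refine Finset.sum_congr rfl fun z _ => ?_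
  rw [pow_add, Finset.prod_mul_distrib, ← mul_assoc]
  congr 2
  · push_cast
    rw [← Finset.prod_pow_eq_pow_sum]
    refine Finset.prod_congr rfl fun i _ => ?_
    rw [← Finset.prod_pow_eq_pow_sum]
    refine Finset.prod_congr rfl fun j _ => ?_
    split_ifs <;> simp
  · rw [← Finset.prod_pow_eq_pow_sum]
    refine Finset.prod_congr rfl fun j _ => ?_
    split_ifs <;> simp

/-- The local factor of `p²` at a vertex whose four bit copies are `q`. -/
def fourPhase (x : Bool) (t : ℝ) (q : (Bool × Bool) × (Bool × Bool)) : ℂ :=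
  localPhase x t q.1.1 * starRingEnd ℂ (localPhase x t q.1.2) *
    (localPhase x t q.2.1 * starRingEnd ℂ (localPhase x t q.2.2))

/-- The product of the signs of the four bit strings combined in `Z`. -/
def fourSign {n : ℕ} (m : Fin n → Fin n → ℕ) (Z : Fin n → (Bool × Bool) × (Bool × Bool)) : ℝ :=
  quadSign m (fun i => (Z i).1.1) * quadSign m (fun i => (Z i).1.2) *
    (quadSign m (fun i => (Z i).2.1) * quadSign m (fun i => (Z i).2.2))

lemma sum_pi_prod_eq {ι α β R : Type*} [Fintype ι] [DecidableEq ι] [Fintype α] [Fintype β]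
    [CommSemiring R] (f : (ι → α) → R) (g : (ι → β) → R) :
    (∑ a, f a) * ∑ b, g b = ∑ Z : ι → α × β, f (fun i => (Z i).1) * g (fun i => (Z i).2) := by
  rw [Finset.sum_mul_sum, ← Fintype.sum_prod_type',
    ← (Equiv.arrowProdEquivProdArrow ι (fun _ => α) (fun _ => β)).sum_comp]
  rfl

lemma ofReal_gsProb_sq (n : ℕ) (m : Fin n → Fin n → ℕ) (θ : Fin n → ℝ) (x : Fin n → Bool) :
    (((gsProb n m θ x) ^ 2 : ℝ) : ℂ) = (1 / 2 ^ n) ^ 4 *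
      ∑ Z : Fin n → (Bool × Bool) × (Bool × Bool),
        (fourSign m Z : ℂ) * ∏ j, fourPhase (x j) (θ j) (Z j) := by
  set S : ℂ := ∑ z : Fin n → Bool, (quadSign m z : ℂ) * ∏ j, localPhase (x j) (θ j) (z j) with hS
  have hconj : starRingEnd ℂ S = ∑ z : Fin n → Bool,
      (quadSign m z : ℂ) * ∏ j, starRingEnd ℂ (localPhase (x j) (θ j) (z j)) := by
    simp [hS, map_sum, map_prod]
  have h1 : (gsProb n m θ x : ℂ) = (1 / 2 ^ n) ^ 2 * (S * starRingEnd ℂ S) := by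
    unfold gsProb
    rw [← Complex.mul_conj, gsAmp_eq_sum_quadSign, ← hS]
    simp only [map_mul, map_div₀, map_one, map_pow, Complex.conj_ofNat]
    ring
  have h2 : S * starRingEnd ℂ S = ∑ Z : Fin n → Bool × Bool,
      ((quadSign m (fun i => (Z i).1) : ℂ) * ∏ j, localPhase (x j) (θ j) (Z j).1) *
      ((quadSign m (fun i => (Z i).2) : ℂ) *
        ∏ j, starRingEnd ℂ (localPhase (x j) (θ j) (Z j).2)) := by
    rw [hconj, hS, sum_pi_prod_eq]
  rw [Complex.ofReal_pow, h1, mul_pow, ← pow_mul, sq (S * _), h2, sum_pi_prod_eq]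
  congr 1
  refine Finset.sum_congr rfl fun Z _ => ?_
  simp only [fourSign, fourPhase, Finset.prod_mul_distrib, Complex.ofReal_mul]
  ring

lemma continuous_localPhase (x b : Bool) : Continuous fun t => localPhase x t b := by
  unfold localPhase; fun_prop

lemma continuous_fourPhase (x : Bool) (q : (Bool × Bool) × (Bool × Bool)) :
    Continuous fun t => fourPhase x t q := by
  unfold fourPhase
  have := continuous_localPhase x
  fun_prop

/-- The four bit copies at a vertex on which the angle average does not vanish. -/
def balanced (q : (Bool × Bool) × (Bool × Bool)) : Bool :=
  (q.1.1 == q.1.2 && q.2.1 == q.2.2) || (q.1.1 == q.2.2 && q.2.1 == q.1.2)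

lemma integral_exp_int (a : ℤ) (ha : a ≠ 0) :
    ∫ t in Set.Icc (0 : ℝ) (2 * Real.pi), Complex.exp ((a : ℂ) * Complex.I * t) = 0 := by
  rw [integral_Icc_eq_integral_Ioc, ← intervalIntegral.integral_of_le (by positivity),
    integral_exp_mul_complex (by simp [ha])]
  have : Complex.exp ((a : ℂ) * Complex.I * ((2 * Real.pi : ℝ) : ℂ)) = 1 := by
    rw [Complex.exp_eq_one_iff]
    exact ⟨a, by push_cast; ring⟩
  rw [this]; simp

lemma integral_fourPhase (x : Bool) (q : (Bool × Bool) × (Bool × Bool)) :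
    ∫ t in Set.Icc (0 : ℝ) (2 * Real.pi), fourPhase x t q
      = (if x ∧ ((q.1.1 ^^ q.1.2) ^^ (q.2.1 ^^ q.2.2)) then -1 else 1) *
        if balanced q then 2 * (Real.pi : ℂ) else 0 := by
  have key : ∃ a : ℤ, (balanced q = true ↔ a = 0) ∧ ∀ t : ℝ, fourPhase x t q =
      (if x ∧ ((q.1.1 ^^ q.1.2) ^^ (q.2.1 ^^ q.2.2)) then -1 else 1) *
        Complex.exp ((a : ℂ) * Complex.I * t) := by
    let s : Bool → ℤ := fun b => if b then 1 else -1
    refine ⟨s q.1.1 - s q.1.2 + (s q.2.1 - s q.2.2), ?_, fun t => ?_⟩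
    · obtain ⟨⟨a, b⟩, ⟨c, d⟩⟩ := q
      revert a b c d
      decide
    · obtain ⟨⟨a, b⟩, ⟨c, d⟩⟩ := q
      have hl : ∀ b : Bool, localPhase x t b =
          (if x ∧ b then -1 else 1) * Complex.exp ((s b : ℂ) * Complex.I * t) := by
        intro b
        cases b <;> simp [localPhase, s]
      have hc : ∀ b : Bool, starRingEnd ℂ (localPhase x t b) =
          (if x ∧ b then -1 else 1) * Complex.exp (-((s b : ℂ) * Complex.I * t)) := by
        intro b
        rw [hl, map_mul, ← Complex.exp_conj]
        congr 1
        · split_ifs <;> simp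
        · simp
      have hexp : Complex.exp (((s a - s b + (s c - s d) : ℤ) : ℂ) * Complex.I * t) =
          Complex.exp ((s a : ℂ) * Complex.I * t) * Complex.exp (-((s b : ℂ) * Complex.I * t)) *
          (Complex.exp ((s c : ℂ) * Complex.I * t) *
            Complex.exp (-((s d : ℂ) * Complex.I * t))) := by
        simp only [← Complex.exp_add]
        congr 1
        push_cast
        ring
      simp only [fourPhase, hc, hexp]
      simp only [hl]
      cases x <;> cases a <;> cases b <;> cases c <;> cases d <;> simp
  obtain ⟨a, ha, h⟩ := key
  simp only [h]
  rw [integral_const_mul]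
  by_cases hb : balanced q = true
  · have h0 := ha.1 hb
    subst h0
    simp [hb, Real.pi_pos.le]
  · have h0 : a ≠ 0 := fun h => hb (ha.2 h)
    rw [integral_exp_int a h0]
    simp [hb]

lemma sum_integral_fourPhase (q : (Bool × Bool) × (Bool × Bool)) :
    ∑ x : Bool, ∫ t in Set.Icc (0 : ℝ) (2 * Real.pi), fourPhase x t q
      = if balanced q then 4 * (Real.pi : ℂ) else 0 := by
  simp only [integral_fourPhase, Fintype.sum_bool]
  obtain ⟨⟨a, b⟩, ⟨c, d⟩⟩ := q
  cases a <;> cases b <;> cases c <;> cases d <;> simp [balanced] <;> ring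

lemma avgSecondMoment_eq_sum_balanced (n : ℕ) (m : Fin n → Fin n → ℕ) :
    avgSecondMoment n m = (1 / 2 ^ n) ^ 2 *
      ∑ Z : Fin n → (Bool × Bool) × (Bool × Bool),
        if ∀ j, balanced (Z j) = true then fourSign m Z else 0 := by
  have hint : ∀ (x : Fin n → Bool) (Z : Fin n → (Bool × Bool) × (Bool × Bool)),
      IntegrableOn (fun θ : Fin n → ℝ => (fourSign m Z : ℂ) * ∏ j, fourPhase (x j) (θ j) (Z j))
        (Set.univ.pi (fun _ : Fin n => Set.Icc (0 : ℝ) (2 * Real.pi))) := by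
    intro x Z
    apply ContinuousOn.integrableOn_compact
    · exact isCompact_univ_pi fun _ => isCompact_Icc
    · have := continuous_fourPhase
      refine Continuous.continuousOn (continuous_const.mul (continuous_finsetProd _ fun j _ => ?_))
      exact (this (x j) (Z j)).comp (continuous_apply j)
  have hI : ∫ θ in Set.univ.pi (fun _ : Fin n => Set.Icc (0 : ℝ) (2 * Real.pi)),
      (secondMoment n m θ : ℂ) = 2 ^ n * ((1 / 2 ^ n) ^ 4 *
        ∑ Z : Fin n → (Bool × Bool) × (Bool × Bool), (fourSign m Z : ℂ) *
          ∏ j, if balanced (Z j) then 4 * (Real.pi : ℂ) else 0) := by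
    have h1 : ∀ θ, (secondMoment n m θ : ℂ) = 2 ^ n * ((1 / 2 ^ n) ^ 4 *
        ∑ x : Fin n → Bool, ∑ Z : Fin n → (Bool × Bool) × (Bool × Bool),
          (fourSign m Z : ℂ) * ∏ j, fourPhase (x j) (θ j) (Z j)) := by
      intro θ
      unfold secondMoment
      push_cast
      simp_rw [← Complex.ofReal_pow, ofReal_gsProb_sq, Finset.mul_sum]
    simp_rw [h1]
    rw [integral_const_mul, integral_const_mul, integral_finsetSum _ fun x _ => ?_]
    · congr 2
      rw [Finset.sum_congr rfl fun x _ => integral_finsetSum _ fun Z _ => hint x Z,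
        Finset.sum_comm]
      refine Finset.sum_congr rfl fun Z _ => ?_
      simp_rw [integral_const_mul]
      rw [← Finset.mul_sum]
      congr 1
      rw [volume_pi, Measure.restrict_pi_pi]
      have h2 : ∀ x : Fin n → Bool, ∫ θ : Fin n → ℝ, ∏ j, fourPhase (x j) (θ j) (Z j)
          ∂(Measure.pi fun _ => volume.restrict (Set.Icc (0 : ℝ) (2 * Real.pi))) =
          ∏ j, ∫ t in Set.Icc (0 : ℝ) (2 * Real.pi), fourPhase (x j) t (Z j) := fun x =>
        integral_fintype_prod_eq_prod (fun j t => fourPhase (x j) t (Z j))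
      simp_rw [h2, ← sum_integral_fourPhase]
      rw [Finset.prod_univ_sum, Fintype.piFinset_univ]
    · exact integrable_finsetSum _ fun Z _ => hint x Z
  have hC : (avgSecondMoment n m : ℂ) = (((1 / 2 ^ n) ^ 2 *
      ∑ Z : Fin n → (Bool × Bool) × (Bool × Bool),
        if ∀ j, balanced (Z j) = true then fourSign m Z else 0 : ℝ) : ℂ) := by
    unfold avgSecondMoment
    rw [Complex.ofReal_mul, ← integral_complex_ofReal, hI]
    have h3 : ∀ Z : Fin n → (Bool × Bool) × (Bool × Bool), (fourSign m Z : ℂ) *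
        ∏ j, (if balanced (Z j) then 4 * (Real.pi : ℂ) else 0) = (4 * (Real.pi : ℂ)) ^ n *
          ((if ∀ j, balanced (Z j) = true then fourSign m Z else 0 : ℝ) : ℂ) := by
      intro Z
      split_ifs with h
      · simp [h, mul_comm]
      · push Not at h
        obtain ⟨j, hj⟩ := h
        rw [Finset.prod_eq_zero (Finset.mem_univ j) (by simp [hj])]
        simp
    simp_rw [h3]
    rw [← Finset.mul_sum]
    have hpi : (Real.pi : ℂ) ≠ 0 := by exact_mod_cast Real.pi_ne_zero
    push_cast
    have h4 : (4 * (Real.pi : ℂ)) ^ n = 2 ^ n * (2 * (Real.pi : ℂ)) ^ n := by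
      rw [← mul_pow]; congr 1; ring
    rw [h4]
    field_simp
  exact_mod_cast hC

/-- The sign of an edge with endpoint colours `p` and `q`: negative exactly between the
colours `0` and `1`. -/
def pairSign (p q : Fin 3) : ℝ := if (p = 0 ∧ q = 1) ∨ (p = 1 ∧ q = 0) then -1 else 1

/-- The balanced bit quadruple determined by its first bit and a colour. -/
def liftColor (y : Bool × Fin 3) : (Bool × Bool) × (Bool × Bool) :=
  ((y.1, y.1 ^^ decide (y.2 = 0)), (y.1 ^^ decide (y.2 ≠ 2), y.1 ^^ decide (y.2 = 1)))

/-- The first bit and the colour of a balanced bit quadruple. -/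
def toColor (q : (Bool × Bool) × (Bool × Bool)) : Bool × Fin 3 :=
  (q.1.1, if q.1.1 ≠ q.1.2 then 0 else if q.1.1 ≠ q.2.2 then 1 else 2)

lemma balanced_liftColor (y) : balanced (liftColor y) = true := by revert y; decide

lemma toColor_liftColor (y) : toColor (liftColor y) = y := by revert y; decide

lemma liftColor_toColor (q) (h : balanced q = true) : liftColor (toColor q) = q := by
  revert q; decide

lemma quadSign_liftColor (y y' : Bool × Fin 3) (k : ℕ) :
    ((if (liftColor y).1.1 = true ∧ (liftColor y').1.1 = true then (-1 : ℝ) ^ k else 1) *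
          if (liftColor y).1.2 = true ∧ (liftColor y').1.2 = true then (-1) ^ k else 1) *
        ((if (liftColor y).2.1 = true ∧ (liftColor y').2.1 = true then (-1) ^ k else 1) *
          if (liftColor y).2.2 = true ∧ (liftColor y').2.2 = true then (-1) ^ k else 1) =
      pairSign y.2 y'.2 ^ k := by
  obtain ⟨a, c⟩ := y
  obtain ⟨b, e⟩ := y'
  have ht : ((-1 : ℝ) ^ k) * (-1) ^ k = 1 := by rw [← mul_pow]; simp
  cases a <;> cases b <;> fin_cases c <;> fin_cases e <;>
    simp [liftColor, pairSign, ht]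

lemma fourSign_liftColor {n : ℕ} (m : Fin n → Fin n → ℕ) (Y : Fin n → Bool × Fin 3) :
    fourSign m (fun i => liftColor (Y i)) =
      ∏ i, ∏ j, if i < j then pairSign (Y i).2 (Y j).2 ^ m i j else 1 := by
  simp only [fourSign, quadSign, ← Finset.prod_mul_distrib]
  refine Finset.prod_congr rfl fun i _ => Finset.prod_congr rfl fun j _ => ?_
  by_cases hij : i < j
  · simpa only [hij, true_and, if_true] using quadSign_liftColor (Y i) (Y j) (m i j)
  · simp [hij]

lemma avgSecondMoment_eq_sum_color (n : ℕ) (m : Fin n → Fin n → ℕ) :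
    avgSecondMoment n m = (1 / 2 ^ n) * ∑ z : Fin n → Fin 3,
      ∏ i, ∏ j, if i < j then pairSign (z i) (z j) ^ m i j else 1 := by
  have h : (∑ Z : Fin n → (Bool × Bool) × (Bool × Bool),
      if ∀ j, balanced (Z j) = true then fourSign m Z else 0) =
      ∑ Y : Fin n → Bool × Fin 3, fourSign m (fun i => liftColor (Y i)) := by
    rw [← Finset.sum_filter]
    refine Finset.sum_nbij' (fun Z i => toColor (Z i)) (fun Y i => liftColor (Y i))
      (by simp) (by simp [balanced_liftColor]) ?_ (by simp [toColor_liftColor]) ?_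
    · intro Z hZ
      funext i
      exact liftColor_toColor _ ((Finset.mem_filter.1 hZ).2 i)
    · intro Z hZ
      congr 1
      funext i
      exact (liftColor_toColor _ ((Finset.mem_filter.1 hZ).2 i)).symm
  have h2 := sum_pi_prod_eq (ι := Fin n) (R := ℝ) (fun _ : Fin n → Bool => (1 : ℝ))
    (fun z : Fin n → Fin 3 => ∏ i, ∏ j, if i < j then pairSign (z i) (z j) ^ m i j else 1)
  rw [avgSecondMoment_eq_sum_balanced, h]
  simp_rw [fourSign_liftColor]
  simp only [one_mul] at h2
  rw [← h2]
  simp only [Finset.sum_const, Finset.card_univ, Fintype.card_pi, Fintype.card_bool,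
    Finset.prod_const, Fintype.card_fin, nsmul_eq_mul]
  push_cast
  field_simp

/-- The sign a perfect matching gives to a colouring: the parity of the number of its edges
between the colours `0` and `1`. -/
def colorSign {n : ℕ} (σ : Equiv.Perm (Fin n)) (z : Fin n → Fin 3) : ℝ :=
  ∏ i, if i < σ i then pairSign (z i) (z (σ i)) else 1

/-- The average of `colorSign` over all perfect matchings. -/
def meanSign {n : ℕ} (z : Fin n → Fin 3) : ℝ :=
  (∑ σ ∈ perfectMatchings (Fin n), colorSign σ z) / (perfectMatchings (Fin n)).card

lemma prod_pairSign_matchingMult (n d : ℕ) (f : Fin d → Equiv.Perm (Fin n)) (z : Fin n → Fin 3) :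
    (∏ i, ∏ j, if i < j then pairSign (z i) (z j) ^ matchingMult n d f i j else 1) =
      ∏ k, colorSign (f k) z := by
  unfold colorSign
  rw [Finset.prod_comm (s := (Finset.univ : Finset (Fin d)))]
  refine Finset.prod_congr rfl fun i _ => ?_
  have h : ∀ j, (if i < j then pairSign (z i) (z j) ^ matchingMult n d f i j else 1) =
      ∏ k, if f k i = j then (if i < j then pairSign (z i) (z j) else 1) else 1 := by
    intro j
    rw [Finset.prod_ite]
    split_ifs <;> simp [matchingMult]
  simp_rw [h]
  rw [Finset.prod_comm]
  refine Finset.prod_congr rfl fun k _ => ?_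
  rw [Finset.prod_ite_eq]
  simp

lemma matchingAvgM2_eq (n d : ℕ) :
    matchingAvgM2 n d = (1 / 2 ^ n) * ∑ z : Fin n → Fin 3, meanSign z ^ d := by
  unfold matchingAvgM2 meanSign
  simp_rw [avgSecondMoment_eq_sum_color, prod_pairSign_matchingMult, div_pow]
  rw [← Finset.sum_div, ← Finset.mul_sum, Finset.sum_comm, mul_div_assoc]
  congr 2
  refine Finset.sum_congr rfl fun z _ => ?_
  rw [← Finset.prod_univ_sum (fun _ : Fin d => perfectMatchings (Fin n))
    (fun _ σ => colorSign σ z)]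
  simp

lemma mem_perfectMatchings {V : Type*} [Fintype V] [DecidableEq V] {σ : Equiv.Perm V} :
    σ ∈ perfectMatchings V ↔ (∀ v, σ (σ v) = v) ∧ ∀ v, σ v ≠ v := by
  simp [perfectMatchings]

/-- The asymmetric half of `pairSign`: negative exactly on the ordered pair `(0, 1)`. -/
def halfSign (p q : Fin 3) : ℝ := if p = 0 ∧ q = 1 then -1 else 1

lemma pairSign_eq_halfSign (p q : Fin 3) : pairSign p q = halfSign p q * halfSign q p := by
  fin_cases p <;> fin_cases q <;> simp [pairSign, halfSign]

lemma prod_ite_lt_mul_eq {n : ℕ} {σ : Equiv.Perm (Fin n)} (hσ : σ ∈ perfectMatchings (Fin n))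
    {R : Type*} [CommMonoid R] (f : Fin n → R) :
    (∏ i, if i < σ i then f i * f (σ i) else 1) = ∏ i, f i := by
  obtain ⟨h1, h2⟩ := mem_perfectMatchings.1 hσ
  have hs : ∀ i, (if i < σ i then f i * f (σ i) else 1) =
      (if i < σ i then f i else 1) * (if i < σ i then f (σ i) else 1) := by
    intro i; split_ifs <;> simp
  have hr : (∏ i, if i < σ i then f (σ i) else 1) = ∏ i, if σ i < i then f i else 1 := by
    rw [← Equiv.prod_comp σ (fun i => if σ i < i then f i else 1)]
    simp [h1]
  simp_rw [hs]
  rw [Finset.prod_mul_distrib, hr, ← Finset.prod_mul_distrib]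
  refine Finset.prod_congr rfl fun i _ => ?_
  rcases lt_or_gt_of_ne (h2 i) with h | h
  · simp [h, h.not_gt]
  · simp [h, h.not_gt]

lemma colorSign_eq_prod_halfSign {n : ℕ} {σ : Equiv.Perm (Fin n)}
    (hσ : σ ∈ perfectMatchings (Fin n)) (z : Fin n → Fin 3) :
    colorSign σ z = ∏ i, halfSign (z i) (z (σ i)) := by
  rw [← prod_ite_lt_mul_eq hσ]
  simp only [colorSign, pairSign_eq_halfSign, (mem_perfectMatchings.1 hσ).1]

lemma perfectMatchings_nonempty {n : ℕ} (hn : Even n) : (perfectMatchings (Fin n)).Nonempty := by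
  refine ⟨Fin.revPerm, mem_perfectMatchings.2 ⟨by simp, fun v hv => ?_⟩⟩
  obtain ⟨k, hk⟩ := hn
  have := congrArg Fin.val hv
  simp only [Fin.revPerm_apply, Fin.val_rev] at this
  omega

lemma abs_colorSign {n : ℕ} (σ : Equiv.Perm (Fin n)) (z : Fin n → Fin 3) :
    |colorSign σ z| = 1 := by
  rw [colorSign, Finset.abs_prod]
  refine Finset.prod_eq_one fun i _ => ?_
  unfold pairSign
  split_ifs <;> simp

lemma abs_meanSign_le {n : ℕ} (z : Fin n → Fin 3) : |meanSign z| ≤ 1 := by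
  rw [meanSign, abs_div, Nat.abs_cast]
  refine div_le_one_of_le₀ ((Finset.abs_sum_le_sum_abs _ _).trans ?_) (Nat.cast_nonneg _)
  simp [abs_colorSign]

lemma meanSign_eq_of_forall {n : ℕ} (hn : Even n) {z : Fin n → Fin 3} {s : ℝ}
    (h : ∀ σ ∈ perfectMatchings (Fin n), colorSign σ z = s) : meanSign z = s := by
  have : ((perfectMatchings (Fin n)).card : ℝ) ≠ 0 := by
    exact_mod_cast (perfectMatchings_nonempty hn).card_pos.ne'
  rw [meanSign, Finset.sum_congr rfl h]
  simp [this]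

lemma meanSign_comp_perm {n : ℕ} (z : Fin n → Fin 3) (π : Equiv.Perm (Fin n)) :
    meanSign (z ∘ π) = meanSign z := by
  unfold meanSign
  congr 1
  have hmem : ∀ (π σ : Equiv.Perm (Fin n)), σ ∈ perfectMatchings (Fin n) →
      π * σ * π⁻¹ ∈ perfectMatchings (Fin n) := by
    intro π σ hσ
    obtain ⟨h1, h2⟩ := mem_perfectMatchings.1 hσ
    refine mem_perfectMatchings.2 ⟨fun v => by simp [h1], fun v hv => h2 (π⁻¹ v) ?_⟩
    rw [Equiv.Perm.eq_inv_iff_eq]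
    exact hv
  refine Finset.sum_nbij' (fun σ => π * σ * π⁻¹) (fun σ => π⁻¹ * σ * π) (hmem π)
    (fun σ hσ => by simpa using hmem π⁻¹ σ hσ) (fun σ _ => by simp [mul_assoc])
    (fun σ _ => by simp [mul_assoc]) fun σ hσ => ?_
  rw [colorSign_eq_prod_halfSign hσ, colorSign_eq_prod_halfSign (hmem π σ hσ),
    ← Equiv.prod_comp π (fun i => halfSign (z i) (z ((π * σ * π⁻¹) i)))]
  simp

/-- The number of vertices of colour `c`. -/
def colorCount {n : ℕ} (z : Fin n → Fin 3) (c : Fin 3) : ℕ :=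
  Fintype.card {i // z i = c}

lemma sum_colorCount {n : ℕ} (z : Fin n → Fin 3) : ∑ c, colorCount z c = n := by
  simpa [colorCount] using Fintype.card_congr (Equiv.sigmaFiberEquiv z)

lemma prod_eq_prod_pow_colorCount {n : ℕ} {R : Type*} [CommMonoid R] (z : Fin n → Fin 3)
    (X : Fin 3 → R) : ∏ i, X (z i) = ∏ c, X c ^ colorCount z c := by
  rw [← Finset.prod_fiberwise' Finset.univ z X]
  simp [colorCount, Fintype.card_subtype]

lemma exists_perm_of_colorCount_eq {n : ℕ} {z z' : Fin n → Fin 3}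
    (h : colorCount z = colorCount z') : ∃ π : Equiv.Perm (Fin n), z' ∘ π = z := by
  have e : ∀ c, Nonempty ({i // z i = c} ≃ {i // z' i = c}) := fun c =>
    Fintype.card_eq.1 (congrFun h c)
  exact ⟨Equiv.ofFiberEquiv (fun c => (e c).some), funext fun i => Equiv.ofFiberEquiv_map _ i⟩

lemma meanSign_eq_of_colorCount_eq {n : ℕ} {z z' : Fin n → Fin 3}
    (h : colorCount z = colorCount z') : meanSign z = meanSign z' := by
  obtain ⟨π, rfl⟩ := exists_perm_of_colorCount_eq h
  exact meanSign_comp_perm _ _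

lemma colorCount_comp_perm {n : ℕ} (z : Fin n → Fin 3) (π : Equiv.Perm (Fin 3)) (c : Fin 3) :
    colorCount (π ∘ z) (π c) = colorCount z c := by
  simp [colorCount]

lemma colorSign_swap_zero_one {n : ℕ} (σ : Equiv.Perm (Fin n)) (z : Fin n → Fin 3) :
    colorSign σ (Equiv.swap 0 1 ∘ z) = colorSign σ z := by
  have h : ∀ p q : Fin 3, pairSign (Equiv.swap 0 1 p) (Equiv.swap 0 1 q) = pairSign p q := by
    intro p q
    have h2 : Equiv.swap (0 : Fin 3) 1 2 = 2 := by decide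
    fin_cases p <;> fin_cases q <;> simp [pairSign, h2]
  simp [colorSign, h]

lemma colorSign_swap_one_two {n : ℕ} {σ : Equiv.Perm (Fin n)}
    (hσ : σ ∈ perfectMatchings (Fin n)) (z : Fin n → Fin 3) :
    colorSign σ (Equiv.swap 1 2 ∘ z) = (-1) ^ colorCount z 0 * colorSign σ z := by
  obtain ⟨h1, h2⟩ := mem_perfectMatchings.1 hσ
  have h : ∀ p q : Fin 3, halfSign (Equiv.swap 1 2 p) (Equiv.swap 1 2 q) =
      (if p = 0 then -1 else 1) * (if p = 0 ∧ q = 0 then -1 else 1) * halfSign p q := by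
    intro p q
    have h2 : Equiv.swap (1 : Fin 3) 2 0 = 0 := by decide
    fin_cases p <;> fin_cases q <;> simp [halfSign, h2]
  have he : (∏ i, if z i = 0 ∧ z (σ i) = 0 then (-1 : ℝ) else 1) = 1 := by
    refine Finset.prod_involution (fun i _ => σ i) (fun i _ => ?_) (fun i _ _ => h2 i)
      (by simp) (fun i _ => h1 i)
    by_cases ha : z i = 0 <;> by_cases hb : z (σ i) = 0 <;> simp [ha, hb, h1]
  rw [colorSign_eq_prod_halfSign hσ, colorSign_eq_prod_halfSign hσ]
  simp only [Function.comp_apply, h]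
  rw [Finset.prod_mul_distrib, Finset.prod_mul_distrib, he, mul_one]
  congr 1
  rw [prod_eq_prod_pow_colorCount z (fun c => if c = 0 then (-1 : ℝ) else 1)]
  simp

lemma meanSign_swap_zero_one {n : ℕ} (z : Fin n → Fin 3) :
    meanSign (Equiv.swap 0 1 ∘ z) = meanSign z := by
  simp [meanSign, colorSign_swap_zero_one]

lemma meanSign_swap_one_two {n : ℕ} (z : Fin n → Fin 3) :
    meanSign (Equiv.swap 1 2 ∘ z) = (-1) ^ colorCount z 0 * meanSign z := by
  unfold meanSign
  rw [Finset.sum_congr rfl fun σ hσ => colorSign_swap_one_two hσ z, ← Finset.mul_sum,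
    mul_div_assoc]

lemma abs_meanSign_comp_perm {n : ℕ} (z : Fin n → Fin 3) (π : Equiv.Perm (Fin 3)) :
    |meanSign (π ∘ z)| = |meanSign z| := by
  have hπ : π ∈ Submonoid.closure (Set.range fun i : Fin 2 => Equiv.swap i.castSucc i.succ) := by
    rw [Equiv.Perm.mclosure_swap_castSucc_succ]; trivial
  induction hπ using Submonoid.closure_induction generalizing z with
  | mem x hx =>
    obtain ⟨i, rfl⟩ := hx
    fin_cases i
    · exact congrArg _ (meanSign_swap_zero_one z)
    · have := meanSign_swap_one_two z
      simp only [Fin.mk_one, Fin.castSucc_one, Fin.succ_one_eq_two]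
      rw [this, abs_mul]
      simp
  | one => simp
  | mul x y _ _ hx hy =>
    rw [Equiv.Perm.coe_mul, Function.comp_assoc, hx, hy]

lemma colorCount_eq_zero {n : ℕ} {z : Fin n → Fin 3} {c : Fin 3} :
    colorCount z c = 0 ↔ ∀ i, z i ≠ c := by
  simp [colorCount, Fintype.card_eq_zero_iff, isEmpty_subtype]

lemma meanSign_of_missing_one {n : ℕ} (hn : Even n) {z : Fin n → Fin 3}
    (h : colorCount z 1 = 0) : meanSign z = 1 := by
  rw [colorCount_eq_zero] at h
  refine meanSign_eq_of_forall hn fun σ hσ => ?_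
  rw [colorSign_eq_prod_halfSign hσ]
  exact Finset.prod_eq_one fun i _ => by simp [halfSign, h]

lemma meanSign_of_missing_zero {n : ℕ} (hn : Even n) {z : Fin n → Fin 3}
    (h : colorCount z 0 = 0) : meanSign z = 1 := by
  rw [colorCount_eq_zero] at h
  refine meanSign_eq_of_forall hn fun σ hσ => ?_
  rw [colorSign_eq_prod_halfSign hσ]
  exact Finset.prod_eq_one fun i _ => by simp [halfSign, h]

lemma meanSign_of_missing_two {n : ℕ} (hn : Even n) {z : Fin n → Fin 3}
    (h : colorCount z 2 = 0) : meanSign z = (-1) ^ colorCount z 0 := by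
  have h1 := meanSign_swap_one_two z
  rw [meanSign_of_missing_one hn] at h1
  · have h2 : ((-1 : ℝ) ^ colorCount z 0) * (-1) ^ colorCount z 0 = 1 := by
      rw [← mul_pow]; simp
    linear_combination (-((-1 : ℝ) ^ colorCount z 0)) * h1 - meanSign z * h2
  · have := colorCount_comp_perm z (Equiv.swap 1 2) 2
    rw [Equiv.swap_apply_right] at this
    rw [this, h]

/-- The quadratic form `x² + y² + z² - 2 x y + 2 x z + 2 y z`. -/
def pairForm {R : Type*} [CommRing R] (X : Fin 3 → R) : R :=
  X 0 ^ 2 + X 1 ^ 2 + X 2 ^ 2 - 2 * X 0 * X 1 + 2 * X 0 * X 2 + 2 * X 1 * X 2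

lemma pairForm_eq_sum {R : Type*} [CommRing R] [Algebra ℝ R] (X : Fin 3 → R) :
    pairForm X = ∑ p : Fin 3 × Fin 3, pairSign p.1 p.2 • (X p.1 * X p.2) := by
  rw [Fintype.sum_prod_type]
  simp [Fin.sum_univ_three, pairSign, pairForm]
  ring

/-- A colouring regarded as a colouring of the edges of a matching by ordered pairs. -/
def edgeColoring {n : ℕ} {σ : Equiv.Perm (Fin n)} (hσ : σ ∈ perfectMatchings (Fin n)) :
    (Fin n → Fin 3) ≃ ({i // i < σ i} → Fin 3 × Fin 3) where
  toFun z r := (z r, z (σ r))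
  invFun y i := if h : i < σ i then (y ⟨i, h⟩).1 else
    (y ⟨σ i, by
      obtain ⟨h1, h2⟩ := mem_perfectMatchings.1 hσ
      rw [h1]
      exact lt_of_le_of_ne (not_lt.1 h) (h2 i)⟩).2
  left_inv z := by
    funext i
    by_cases h : i < σ i <;> simp [h, (mem_perfectMatchings.1 hσ).1]
  right_inv y := by
    funext r
    have h : ¬ σ r < r := not_lt.2 r.2.le
    ext1 <;> simp [h, (mem_perfectMatchings.1 hσ).1, r.2]

lemma prod_ite_lt_eq_prod_subtype {n : ℕ} {R : Type*} [CommMonoid R] (σ : Equiv.Perm (Fin n))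
    (f : Fin n → R) : (∏ i, if i < σ i then f i else 1) = ∏ r : {i // i < σ i}, f r := by
  rw [← Finset.prod_filter, Finset.prod_subtype]
  simp

lemma card_edges_of_mem_perfectMatchings {k : ℕ} {σ : Equiv.Perm (Fin (2 * k))}
    (hσ : σ ∈ perfectMatchings (Fin (2 * k))) : Fintype.card {i // i < σ i} = k := by
  have h := prod_ite_lt_mul_eq hσ (fun _ => (2 : ℕ))
  rw [prod_ite_lt_eq_prod_subtype σ (fun _ => 2 * 2)] at h
  simp only [Finset.prod_const, Finset.card_univ, Fintype.card_fin, pow_mul] at h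
  exact Nat.pow_right_injective (le_refl 4 |>.trans' (by norm_num)) h

lemma sum_colorSign_smul_prod {k : ℕ} {σ : Equiv.Perm (Fin (2 * k))}
    (hσ : σ ∈ perfectMatchings (Fin (2 * k))) {R : Type*} [CommRing R] [Algebra ℝ R]
    (X : Fin 3 → R) : ∑ z, colorSign σ z • ∏ i, X (z i) = pairForm X ^ k := by
  have h : ∀ z : Fin (2 * k) → Fin 3, colorSign σ z • ∏ i, X (z i) =
      ∏ r : {i // i < σ i}, pairSign (edgeColoring hσ z r).1 (edgeColoring hσ z r).2 •
        (X (edgeColoring hσ z r).1 * X (edgeColoring hσ z r).2) := by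
    intro z
    rw [colorSign, prod_ite_lt_eq_prod_subtype σ (fun i => pairSign (z i) (z (σ i))),
      ← prod_ite_lt_mul_eq hσ,
      prod_ite_lt_eq_prod_subtype σ (fun i => X (z i) * X (z (σ i))), ← Finset.prod_smul]
    rfl
  simp_rw [h]
  rw [Equiv.sum_comp (edgeColoring hσ) (fun y => ∏ r, pairSign (y r).1 (y r).2 •
      (X (y r).1 * X (y r).2)), pairForm_eq_sum, ← Fintype.piFinset_univ,
    ← Finset.prod_univ_sum (ι := {i // i < σ i})
      (fun _ => (Finset.univ : Finset (Fin 3 × Fin 3)))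
      (fun _ p => pairSign p.1 p.2 • (X p.1 * X p.2)),
    Finset.prod_const, Finset.card_univ, card_edges_of_mem_perfectMatchings hσ]

lemma sum_meanSign_smul_prod (k : ℕ) {R : Type*} [CommRing R] [Algebra ℝ R] (X : Fin 3 → R) :
    ∑ z : Fin (2 * k) → Fin 3, meanSign z • ∏ i, X (z i) = pairForm X ^ k := by
  have hc : ((perfectMatchings (Fin (2 * k))).card : ℝ) ≠ 0 := by
    exact_mod_cast (perfectMatchings_nonempty (even_two_mul k)).card_pos.ne'
  have h : ((perfectMatchings (Fin (2 * k))).card : ℝ) •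
      ∑ z : Fin (2 * k) → Fin 3, meanSign z • ∏ i, X (z i) =
      ((perfectMatchings (Fin (2 * k))).card : ℝ) • pairForm X ^ k := by
    rw [Finset.smul_sum]
    simp_rw [smul_smul, meanSign, mul_div_cancel₀ _ hc, Finset.sum_smul]
    rw [Finset.sum_comm, Finset.sum_congr rfl fun σ hσ => sum_colorSign_smul_prod hσ X]
    simp [Nat.cast_smul_eq_nsmul]
  have h2 := congrArg (fun x => ((perfectMatchings (Fin (2 * k))).card : ℝ)⁻¹ • x) h
  simpa [smul_smul, hc] using h2

/-- The number of colourings with the same colour counts as `z`. -/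
def classSize {n : ℕ} (z : Fin n → Fin 3) : ℕ :=
  (Finset.univ.filter fun z' : Fin n → Fin 3 => colorCount z' = colorCount z).card

lemma classSize_pos {n : ℕ} (z : Fin n → Fin 3) : 0 < classSize z :=
  Finset.card_pos.2 ⟨z, by simp⟩

lemma classSize_mul_prod_factorial {n : ℕ} (z : Fin n → Fin 3) :
    classSize z * ∏ c, (colorCount z c).factorial = n.factorial := by
  have h := Finset.card_eq_sum_card_fiberwise (s := (Finset.univ : Finset (Equiv.Perm (Fin n))))
    (t := Finset.univ.filter fun z' : Fin n → Fin 3 => colorCount z' = colorCount z)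
    (f := fun π : Equiv.Perm (Fin n) => z ∘ π) (by
      intro π _
      have : colorCount (z ∘ π) = colorCount z := by
        funext c
        exact Fintype.card_congr (π.subtypeEquiv (by simp))
      simpa using this)
  rw [Finset.card_univ, Fintype.card_perm, Fintype.card_fin] at h
  rw [h, classSize, Finset.card_eq_sum_ones, Finset.sum_mul]
  refine Finset.sum_congr rfl fun z' hz' => ?_
  obtain ⟨τ, rfl⟩ := exists_perm_of_colorCount_eq (Finset.mem_filter.1 hz').2
  have h2 := DomMulAct.stabilizer_card z
  rw [one_mul]
  simp only [colorCount]
  rw [← h2, Fintype.card_subtype]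
  refine Finset.card_bij (fun g _ => g * τ) ?_ (by simp) ?_
  · intro g hg
    simp only [Finset.mem_filter, Finset.mem_univ, true_and] at hg ⊢
    rw [Equiv.Perm.coe_mul, ← Function.comp_assoc, hg]
  · intro g hg
    refine ⟨g * τ⁻¹, ?_, by simp⟩
    simp only [Finset.mem_filter, Finset.mem_univ, true_and] at hg ⊢
    rw [Equiv.Perm.coe_mul, ← Function.comp_assoc, hg]
    funext i; simp

/-- The coefficient of `p` at the exponent `m`, in the basis of divided powers. -/
def factCoeff (p : MvPolynomial (Fin 3) ℝ) (m : Fin 3 →₀ ℕ) : ℝ :=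
  p.coeff m * ∏ c, ((m c).factorial : ℝ)

lemma factCoeff_pderiv (p : MvPolynomial (Fin 3) ℝ) (m : Fin 3 →₀ ℕ) (s : Fin 3) :
    factCoeff (MvPolynomial.pderiv s p) m = factCoeff p (m + Finsupp.single s 1) := by
  rw [factCoeff, factCoeff, MvPolynomial.coeff_pderiv]
  fin_cases s <;> simp [Fin.prod_univ_three, Nat.factorial_succ] <;> ring

lemma factCoeff_X_mul (p : MvPolynomial (Fin 3) ℝ) (m : Fin 3 →₀ ℕ) (s : Fin 3) :
    factCoeff (MvPolynomial.X s * p) m = m s * factCoeff p (m - Finsupp.single s 1) := by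
  rw [factCoeff, factCoeff, MvPolynomial.coeff_X_mul']
  by_cases h : m s = 0
  · simp [h]
  · rw [if_pos (by simpa using h)]
    have := Nat.mul_factorial_pred h
    fin_cases s <;> simp only [Fin.prod_univ_three] <;> simp <;> simp at this <;>
      rw [← this] <;> push_cast <;> ring

lemma factCoeff_C_mul (p : MvPolynomial (Fin 3) ℝ) (a : ℝ) (m : Fin 3 →₀ ℕ) :
    factCoeff (MvPolynomial.C a * p) m = a * factCoeff p m := by
  simp [factCoeff, mul_assoc]

/-- The exponent with the given three coordinates. -/
def tripleExp (u v w : ℕ) : Fin 3 →₀ ℕ :=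
  Finsupp.equivFunOnFinite.symm ![u, v, w]

/-- The average sign of the colourings with `u`, `v`, `w` vertices of the three colours,
expressed as a normalised coefficient of a power of `pairForm`. -/
def countSign (k u v w : ℕ) : ℝ :=
  factCoeff (pairForm MvPolynomial.X ^ k) (tripleExp u v w) / (2 * k).factorial

lemma meanSign_eq_countSign {k : ℕ} (z : Fin (2 * k) → Fin 3) :
    meanSign z = countSign k (colorCount z 0) (colorCount z 1) (colorCount z 2) := by
  have hm : ∀ z' : Fin (2 * k) → Fin 3,
      ∏ i, (MvPolynomial.X (z' i) : MvPolynomial (Fin 3) ℝ) =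
        MvPolynomial.monomial (Finsupp.equivFunOnFinite.symm (colorCount z')) 1 := by
    intro z'
    rw [prod_eq_prod_pow_colorCount, MvPolynomial.monomial_eq, Finsupp.prod_fintype _ _ (by simp)]
    simp
  have ht : tripleExp (colorCount z 0) (colorCount z 1) (colorCount z 2) =
      Finsupp.equivFunOnFinite.symm (colorCount z) := by
    ext c; fin_cases c <;> simp [tripleExp]
  have hf : ((2 * k).factorial : ℝ) ≠ 0 := by exact_mod_cast (Nat.factorial_pos _).ne'
  have hT : ((classSize z : ℝ)) * ∏ c, ((colorCount z c).factorial : ℝ) = (2 * k).factorial := by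
    exact_mod_cast classSize_mul_prod_factorial z
  rw [countSign, ht, factCoeff, ← sum_meanSign_smul_prod, eq_div_iff hf, ← hT]
  simp only [hm, MvPolynomial.coeff_sum, MvPolynomial.coeff_smul, MvPolynomial.coeff_monomial,
    EmbeddingLike.apply_eq_iff_eq, smul_eq_mul, mul_ite, mul_one, mul_zero]
  rw [← Finset.sum_filter, Finset.sum_congr rfl fun z' hz' =>
    meanSign_eq_of_colorCount_eq (Finset.mem_filter.1 hz').2, Finset.sum_const, classSize]
  simp
  ring

lemma exists_colorCount {n : ℕ} (m : Fin 3 → ℕ) (h : ∑ c, m c = n) :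
    ∃ z : Fin n → Fin 3, colorCount z = m := by
  have e : Nonempty (Fin n ≃ Σ c, Fin (m c)) := Fintype.card_eq.1 (by simp [h])
  refine ⟨fun i => (e.some i).1, funext fun c => ?_⟩
  have e2 : {i // (e.some i).1 = c} ≃ Fin (m c) :=
    (e.some.subtypeEquiv fun i => Iff.rfl).trans (Equiv.sigmaSubtype c)
  simpa [colorCount] using Fintype.card_congr e2

lemma abs_countSign_le {k u v w : ℕ} (h : u + v + w = 2 * k) : |countSign k u v w| ≤ 1 := by
  obtain ⟨z, hz⟩ := exists_colorCount (n := 2 * k) ![u, v, w] (by simpa [Fin.sum_univ_three])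
  have := meanSign_eq_countSign z
  simp only [hz] at this
  exact this.symm ▸ abs_meanSign_le z

lemma tripleExp_add (u v w : ℕ) (s : Fin 3) : tripleExp u v w + Finsupp.single s 1 =
    tripleExp (u + if s = 0 then 1 else 0) (v + if s = 1 then 1 else 0)
      (w + if s = 2 then 1 else 0) := by
  ext c; fin_cases s <;> fin_cases c <;> simp [tripleExp]

lemma tripleExp_sub (u v w : ℕ) (s : Fin 3) : tripleExp u v w - Finsupp.single s 1 =
    tripleExp (u - if s = 0 then 1 else 0) (v - if s = 1 then 1 else 0)
      (w - if s = 2 then 1 else 0) := by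
  ext c; fin_cases s <;> fin_cases c <;> simp [tripleExp]

lemma pderiv_pairForm_pow (k : ℕ) (s : Fin 3) (a b c : ℝ)
    (h : MvPolynomial.pderiv s (pairForm (MvPolynomial.X : Fin 3 → MvPolynomial (Fin 3) ℝ)) =
      MvPolynomial.C a * MvPolynomial.X 0 + MvPolynomial.C b * MvPolynomial.X 1 +
        MvPolynomial.C c * MvPolynomial.X 2) (m : Fin 3 →₀ ℕ) :
    factCoeff (pairForm MvPolynomial.X ^ (k + 1)) (m + Finsupp.single s 1) =
      (k + 1) * (a * (m 0 * factCoeff (pairForm MvPolynomial.X ^ k) (m - Finsupp.single 0 1)) +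
        b * (m 1 * factCoeff (pairForm MvPolynomial.X ^ k) (m - Finsupp.single 1 1)) +
        c * (m 2 * factCoeff (pairForm MvPolynomial.X ^ k) (m - Finsupp.single 2 1))) := by
  rw [← factCoeff_pderiv, MvPolynomial.pderiv_pow, h]
  rw [← factCoeff_X_mul _ m 0, ← factCoeff_X_mul _ m 1, ← factCoeff_X_mul _ m 2]
  simp only [← factCoeff_C_mul]
  have hk : ((k : ℝ) + 1) = ((k + 1 : ℕ) : ℝ) := by push_cast; ring
  rw [hk]
  have hadd : ∀ p q : MvPolynomial (Fin 3) ℝ, factCoeff p m + factCoeff q m =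
      factCoeff (p + q) m := by
    intro p q; simp [factCoeff, add_mul]
  rw [hadd, hadd, ← factCoeff_C_mul]
  congr 1
  rw [add_tsub_cancel_right]
  simp only [map_natCast]
  ring

lemma pderiv_pairForm (s : Fin 3) :
    MvPolynomial.pderiv s (pairForm (MvPolynomial.X : Fin 3 → MvPolynomial (Fin 3) ℝ)) =
      MvPolynomial.C (if s = 1 then -2 else 2) * MvPolynomial.X 0 +
        MvPolynomial.C (if s = 0 then -2 else 2) * MvPolynomial.X 1 +
        MvPolynomial.C 2 * MvPolynomial.X 2 := by
  have h2 : MvPolynomial.pderiv s (2 : MvPolynomial (Fin 3) ℝ) = 0 := by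
    rw [← map_ofNat MvPolynomial.C 2, MvPolynomial.pderiv_C]
  have h3 : (MvPolynomial.C 2 : MvPolynomial (Fin 3) ℝ) = 2 := map_ofNat MvPolynomial.C 2
  fin_cases s <;>
    simp [pairForm, MvPolynomial.pderiv_X, h3] <;>
    simp only [Fin.zero_eta, Fin.mk_one, Fin.reduceFinMk] at h2 <;> simp [h2] <;> ring

lemma countSign_succ (k u v w : ℕ) (s : Fin 3) :
    (2 * k + 1) * countSign (k + 1) (u + if s = 0 then 1 else 0) (v + if s = 1 then 1 else 0)
        (w + if s = 2 then 1 else 0) =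
      (if s = 1 then -1 else 1) * (u * countSign k (u - 1) v w) +
        (if s = 0 then -1 else 1) * (v * countSign k u (v - 1) w) +
        w * countSign k u v (w - 1) := by
  have h := pderiv_pairForm_pow k s _ _ _ (pderiv_pairForm s) (tripleExp u v w)
  simp only [tripleExp_add, tripleExp_sub] at h
  have hf : ((2 * k).factorial : ℝ) ≠ 0 := by exact_mod_cast (Nat.factorial_pos _).ne'
  have hf2 : ((2 * (k + 1)).factorial : ℝ) = 2 * (k + 1) * (2 * k + 1) * (2 * k).factorial := by
    rw [show 2 * (k + 1) = 2 * k + 1 + 1 by ring, Nat.factorial_succ, Nat.factorial_succ]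
    push_cast; ring
  have hk : (2 * (k : ℝ) + 1) ≠ 0 := by positivity
  have hk2 : ((k : ℝ) + 1) ≠ 0 := by positivity
  have h0 : tripleExp u v w 0 = u := rfl
  have h1 : tripleExp u v w 1 = v := rfl
  have h2 : tripleExp u v w 2 = w := rfl
  simp only [h0, h1, h2] at h
  simp only [countSign, hf2, h]
  fin_cases s <;> simp <;> field_simp

lemma countSign_succ_succ (k u v w : ℕ) :
    (2 * k + 3) * countSign (k + 2) (u + 1) (v + 1) (w + 1) =
      u * countSign (k + 1) (u - 1) (v + 1) (w + 1) +
        (w - v) * countSign (k + 1) u (v + 1) w -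
        2 * u * (v + 1) / (2 * k + 1) * countSign k (u - 1) v w := by
  have h0 := countSign_succ (k + 1) u (v + 1) (w + 1) 0
  have h1 := countSign_succ k u v w 1
  have h2 := countSign_succ k u v w 2
  simp at h0 h1 h2
  have hk : (2 * (k : ℝ) + 1) ≠ 0 := by positivity
  have h3 : countSign (k + 1) u v (w + 1) =
      countSign (k + 1) u (v + 1) w + 2 * u / (2 * k + 1) * countSign k (u - 1) v w := by
    field_simp
    linarith
  rw [h3] at h0
  linear_combination h0

/-- Decay of the mean sign in the smallest colour count. -/
lemma abs_countSign_le_pow {ε m : ℝ} (hε : 0 < ε) (hε1 : ε ≤ 1) (hm : 0 < m) :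
    ∀ (u k v w : ℕ), u + v + w = 2 * k → m ≤ (v : ℝ) + w - u →
      |(w : ℝ) - v| + u ≤ ε * m / 2 → 3 * (u : ℝ) ≤ ε ^ 2 * m / 2 →
      |countSign k u v w| ≤ ε ^ u := by
  intro u
  induction u using Nat.strong_induction_on with
  | _ u ih =>
  rcases u with _ | u
  · intro k v w h _ _ _
    simpa using abs_countSign_le h
  intro k v w hk h1 h2 h3
  have hem : ε * m ≤ m := mul_le_of_le_one_left hm.le hε1
  push_cast at h1 h2 h3
  have hu0 : (0 : ℝ) ≤ u := Nat.cast_nonneg u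
  obtain ⟨h2a, h2b⟩ := abs_le.1 (show |(w : ℝ) - v| ≤ ε * m / 2 - (u + 1) by linarith)
  obtain ⟨v, rfl⟩ : ∃ v', v = v' + 1 := Nat.exists_eq_succ_of_ne_zero fun h => by
    subst h; push_cast at *; linarith
  obtain ⟨w, rfl⟩ : ∃ w', w = w' + 1 := Nat.exists_eq_succ_of_ne_zero fun h => by
    subst h; push_cast at *; linarith
  obtain ⟨k, rfl⟩ : ∃ k', k = k' + 2 := ⟨k - 2, by omega⟩
  have hrec := countSign_succ_succ k u v w
  push_cast at h1 h2 h3 h2a h2b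
  have hkR : (u : ℝ) + v + w = 2 * k + 1 := by
    have : u + v + w = 2 * k + 1 := by omega
    exact_mod_cast this
  have hv0 : (0 : ℝ) ≤ v := Nat.cast_nonneg v
  have hw0 : (0 : ℝ) ≤ w := Nat.cast_nonneg w
  have hd : |(w : ℝ) - v| ≤ ε * m / 2 := by rw [abs_le]; constructor <;> linarith
  have hB : |countSign (k + 1) u (v + 1) w| ≤ ε ^ u := by
    refine ih u (Nat.lt_succ_self u) (k + 1) (v + 1) w (by omega) (by push_cast; linarith) ?_
      (by linarith)
    have : |(w : ℝ) - ((v + 1 : ℕ) : ℝ)| ≤ ε * m / 2 - u := by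
      push_cast; rw [abs_le]; constructor <;> linarith
    linarith
  have hAC : |(u : ℝ) * countSign (k + 1) (u - 1) (v + 1) (w + 1) -
      2 * u * (v + 1) / (2 * k + 1) * countSign k (u - 1) v w| * ε ≤ 3 * u * ε ^ u := by
    rcases u with _ | u
    · simp
    push_cast at *
    have hA : |countSign (k + 1) u (v + 1) (w + 1)| ≤ ε ^ u := by
      refine ih u (by omega) (k + 1) (v + 1) (w + 1) (by omega) (by push_cast; linarith) ?_
        (by linarith)
      push_cast; linarith
    have hC : |countSign k u v w| ≤ ε ^ u := by
      refine ih u (by omega) k v w (by omega) (by linarith) ?_ (by linarith)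
      have : |(w : ℝ) - v| ≤ ε * m / 2 - u := by rw [abs_le]; constructor <;> linarith
      linarith
    have hc : 2 * ((u : ℝ) + 1) * (v + 1) / (2 * k + 1) ≤ 2 * (u + 1) := by
      rw [div_le_iff₀ (by positivity)]
      have : (v : ℝ) + 1 ≤ 2 * k + 1 := by linarith [Nat.cast_nonneg (α := ℝ) u]
      nlinarith [Nat.cast_nonneg (α := ℝ) u]
    have hc0 : 0 ≤ 2 * ((u : ℝ) + 1) * (v + 1) / (2 * k + 1) := by positivity
    have hpow := pow_nonneg hε.le u
    have h4 : |((u : ℝ) + 1) * countSign (k + 1) u (v + 1) (w + 1) -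
        2 * (u + 1) * (v + 1) / (2 * k + 1) * countSign k u v w| ≤ 3 * (u + 1) * ε ^ u := by
      refine (abs_sub _ _).trans ?_
      rw [abs_mul, abs_mul, abs_of_nonneg hc0, abs_of_nonneg (by positivity : (0 : ℝ) ≤ u + 1)]
      have := mul_le_mul_of_nonneg_left hA (by positivity : (0 : ℝ) ≤ u + 1)
      have := mul_le_mul hc hC (abs_nonneg _) (by positivity)
      linarith
    calc _ ≤ 3 * ((u : ℝ) + 1) * ε ^ u * ε := mul_le_mul_of_nonneg_right h4 hε.le
      _ = _ := by ring
  have hpow := pow_nonneg hε.le u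
  have key : (2 * (k : ℝ) + 3) * |countSign (k + 2) (u + 1) (v + 1) (w + 1)| * ε ≤
      m * ε ^ (u + 1) * ε := by
    have hk0 : (0 : ℝ) ≤ 2 * k + 3 := by positivity
    rw [← abs_of_nonneg hk0, ← abs_mul, hrec]
    have h5 := abs_add_le ((u : ℝ) * countSign (k + 1) (u - 1) (v + 1) (w + 1) -
      2 * u * (v + 1) / (2 * k + 1) * countSign k (u - 1) v w)
      ((w - v) * countSign (k + 1) u (v + 1) w)
    have h6 : |((w : ℝ) - v) * countSign (k + 1) u (v + 1) w| ≤ ε * m / 2 * ε ^ u := by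
      rw [abs_mul]
      exact mul_le_mul hd hB (abs_nonneg _) (by positivity)
    have h7 : 3 * (u : ℝ) * ε ^ u ≤ ε ^ 2 * m / 2 * ε ^ u :=
      mul_le_mul_of_nonneg_right (by linarith) hpow
    calc _ = |(u : ℝ) * countSign (k + 1) (u - 1) (v + 1) (w + 1) -
      2 * u * (v + 1) / (2 * k + 1) * countSign k (u - 1) v w +
      (w - v) * countSign (k + 1) u (v + 1) w| * ε := by congr 2; ring
      _ ≤ (|(u : ℝ) * countSign (k + 1) (u - 1) (v + 1) (w + 1) -
      2 * u * (v + 1) / (2 * k + 1) * countSign k (u - 1) v w| +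
      ε * m / 2 * ε ^ u) * ε := mul_le_mul_of_nonneg_right (by linarith) hε.le
      _ ≤ ε ^ 2 * m / 2 * ε ^ u + ε * m / 2 * ε ^ u * ε := by
        rw [add_mul]; linarith
      _ = _ := by ring
  have key2 := le_of_mul_le_mul_right key hε
  have hmk : m ≤ 2 * k + 3 := by linarith
  have hpow1 := pow_nonneg hε.le (u + 1)
  have : (2 * (k : ℝ) + 3) * |countSign (k + 2) (u + 1) (v + 1) (w + 1)| ≤
      (2 * k + 3) * ε ^ (u + 1) := key2.trans (mul_le_mul_of_nonneg_right hmk hpow1)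
  exact le_of_mul_le_mul_left this (by positivity)

/-- A block of coefficients of a trigonometric polynomial is bounded by its supremum. -/
lemma norm_sum_filter_le {ι : Type*} (s : Finset ι) (a : ι → ℂ) (e : ι → ℕ) {N e₀ : ℕ}
    (hN : ∀ i ∈ s, e i < N) (he₀ : e₀ < N) {B : ℝ}
    (h : ∀ ω : ℂ, ‖ω‖ = 1 → ‖∑ i ∈ s, a i * ω ^ e i‖ ≤ B) :
    ‖∑ i ∈ s with e i = e₀, a i‖ ≤ B := by
  have hN0 : N ≠ 0 := by omega
  have hζ := Complex.isPrimitiveRoot_exp N hN0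
  set ζ : ℂ := Complex.exp (2 * Real.pi * Complex.I / N)
  have hζ1 : ‖ζ‖ = 1 := hζ.norm'_eq_one hN0
  have hgeom : ∀ i ∈ s, ∑ j ∈ Finset.range N, (ζ ^ j) ^ (N - e₀) * (ζ ^ j) ^ e i =
      if e i = e₀ then (N : ℂ) else 0 := by
    intro i hi
    have hr : ∀ j, (ζ ^ j) ^ (N - e₀) * (ζ ^ j) ^ e i = (ζ ^ (N - e₀ + e i)) ^ j := by
      intro j
      rw [← pow_add, ← pow_mul, ← pow_mul, mul_comm]
    simp_rw [hr]
    split_ifs with hie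
    · rw [show N - e₀ + e i = N by omega, hζ.pow_eq_one]
      simp
    · have hne : ζ ^ (N - e₀ + e i) ≠ 1 := by
        rw [Ne, hζ.pow_eq_one_iff_dvd]
        rintro ⟨c, hc⟩
        have := hN i hi
        have hc1 : c = 1 := by
          rcases c with _ | _ | c
          · omega
          · rfl
          · have := Nat.mul_le_mul_left N (show 2 ≤ c + 1 + 1 by omega)
            omega
        subst hc1
        omega
      rw [geom_sum_eq hne, ← pow_mul, mul_comm, pow_mul, hζ.pow_eq_one]
      simp
  have key : (N : ℂ) * ∑ i ∈ s with e i = e₀, a i =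
      ∑ j ∈ Finset.range N, (ζ ^ j) ^ (N - e₀) * ∑ i ∈ s, a i * (ζ ^ j) ^ e i := by
    simp_rw [Finset.mul_sum]
    rw [Finset.sum_comm, Finset.sum_filter]
    refine Finset.sum_congr rfl fun i hi => ?_
    calc _ = a i * (if e i = e₀ then (N : ℂ) else 0) := by split_ifs <;> ring
      _ = _ := by
        rw [← hgeom i hi, Finset.mul_sum]
        exact Finset.sum_congr rfl fun j _ => by ring
  have hle : (N : ℝ) * ‖∑ i ∈ s with e i = e₀, a i‖ ≤ N * B := by
    rw [← Complex.norm_natCast, ← norm_mul, key, Complex.norm_natCast]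
    refine (norm_sum_le _ _).trans ?_
    refine (Finset.sum_le_card_nsmul _ _ B fun j _ => ?_).trans (by simp)
    rw [norm_mul, norm_pow, norm_pow, hζ1]
    simpa using h (ζ ^ j) (by simp [hζ1])
  exact le_of_mul_le_mul_left hle (by positivity)

/-- The saddle point bound: the values of `pairForm` on a torus control the mean sign. -/
lemma classSize_mul_abs_meanSign_le {k : ℕ} (z : Fin (2 * k) → Fin 3) {x : Fin 3 → ℝ}
    (hx : ∀ c, 0 ≤ x c) {M : ℝ} (hM : ∀ X : Fin 3 → ℂ, (∀ c, ‖X c‖ = x c) → ‖pairForm X‖ ≤ M) :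
    classSize z * |meanSign z| * ∏ c, x c ^ colorCount z c ≤ M ^ k := by
  have hM0 : 0 ≤ M := (norm_nonneg _).trans (hM (fun c => x c) fun c => by
    rw [Complex.norm_real, Real.norm_of_nonneg (hx c)])
  have hlt : ∀ z : Fin (2 * k) → Fin 3, colorCount z 0 + colorCount z 1 ≤ 2 * k := fun z => by
    have := sum_colorCount z
    rw [Fin.sum_univ_three] at this
    omega
  have hmain := norm_sum_filter_le Finset.univ
    (fun z' : Fin (2 * k) → Fin 3 => ((meanSign z' * ∏ c, x c ^ colorCount z' c : ℝ) : ℂ))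
    (fun z' => colorCount z' 0 + (2 * k + 1) * colorCount z' 1) (N := (2 * k + 1) ^ 2)
    (e₀ := colorCount z 0 + (2 * k + 1) * colorCount z 1) (B := M ^ k)
    (fun z' _ => by nlinarith [hlt z']) (by nlinarith [hlt z]) ?_
  · have hf : ∀ z' : Fin (2 * k) → Fin 3,
        colorCount z' 0 + (2 * k + 1) * colorCount z' 1 =
          colorCount z 0 + (2 * k + 1) * colorCount z 1 ↔
        colorCount z' = colorCount z := by
      intro z'
      refine ⟨fun h => ?_, fun h => by rw [h]⟩
      have h0 : colorCount z' 0 = colorCount z 0 := by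
        have := congrArg (· % (2 * k + 1)) h
        simpa [Nat.add_mul_mod_self_left, Nat.mod_eq_of_lt, Nat.lt_succ_of_le,
          (Nat.le_add_right _ _).trans (hlt z), (Nat.le_add_right _ _).trans (hlt z')] using this
      have h1 : colorCount z' 1 = colorCount z 1 := by
        rw [h0] at h
        exact Nat.eq_of_mul_eq_mul_left (Nat.succ_pos (2 * k)) (Nat.add_left_cancel h)
      have h2 := (sum_colorCount z').trans (sum_colorCount z).symm
      rw [Fin.sum_univ_three, Fin.sum_univ_three, h0, h1] at h2
      funext c
      fin_cases c
      exacts [h0, h1, Nat.add_left_cancel h2]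
    simp only [hf] at hmain
    rw [Finset.sum_congr rfl fun z' hz' => by
      rw [meanSign_eq_of_colorCount_eq (Finset.mem_filter.1 hz').2,
        (Finset.mem_filter.1 hz').2]] at hmain
    rw [Finset.sum_const, nsmul_eq_mul, norm_mul, Complex.norm_natCast, Complex.norm_real,
      Real.norm_eq_abs, abs_mul, abs_of_nonneg
        (Finset.prod_nonneg fun c _ => pow_nonneg (hx c) _), ← mul_assoc] at hmain
    exact hmain
  · intro ω hω
    let X : Fin 3 → ℂ := ![x 0 * ω, x 1 * ω ^ (2 * k + 1), x 2]
    have hX : ∀ c, ‖X c‖ = x c := by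
      intro c
      fin_cases c <;> simp [X, hω, abs_of_nonneg, hx]
    have := sum_meanSign_smul_prod k X
    have h2 : (∑ z' : Fin (2 * k) → Fin 3, ((meanSign z' * ∏ c, x c ^ colorCount z' c : ℝ) : ℂ) *
        ω ^ (colorCount z' 0 + (2 * k + 1) * colorCount z' 1)) = pairForm X ^ k := by
      rw [← this]
      refine Finset.sum_congr rfl fun z' _ => ?_
      rw [prod_eq_prod_pow_colorCount, Fin.prod_univ_three, Fin.prod_univ_three]
      simp [X]
      ring
    rw [h2, norm_pow]
    exact pow_le_pow_left₀ (norm_nonneg _) (hM X hX) k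

lemma norm_pairForm_le_of_norms {X : Fin 3 → ℂ} {x y z : ℝ} (hx : ‖X 0‖ = x) (hy : ‖X 1‖ = y)
    (hz : ‖X 2‖ = z) : ‖pairForm X‖ ≤ 2 * (x ^ 2 + y ^ 2 + z ^ 2) ∧
      (x ≤ z - y → ‖pairForm X‖ ≤ x ^ 2 + (y + z) ^ 2 + 2 * x * (z - y)) := by
  have h1 : pairForm X = (X 2 + X 1) * (X 2 + X 1) + 2 * X 0 * (X 2 - X 1) + X 0 ^ 2 := by
    unfold pairForm; ring
  have h2 := parallelogram_law_with_norm ℝ (X 2) (X 1)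
  have h3 := norm_sub_norm_le (X 2) (X 1)
  have h4 : ‖pairForm X‖ ≤ ‖X 2 + X 1‖ * ‖X 2 + X 1‖ + 2 * ‖X 0‖ * ‖X 2 - X 1‖ + ‖X 0‖ ^ 2 := by
    rw [h1]
    refine (norm_add₃_le).trans ?_
    simp
  rw [hy, hz] at h2 h3
  rw [hx] at h4
  refine ⟨by nlinarith [sq_nonneg (‖X 2 - X 1‖ - x)], fun h => ?_⟩
  nlinarith [mul_nonneg (sub_nonneg.2 h3) (sub_nonneg.2 h),
    mul_nonneg (sub_nonneg.2 h3) (sub_nonneg.2 h3)]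

lemma slack_of_sq_le {a p : ℝ} (ha : 0 ≤ a) (hp : 0 ≤ p) (hap : p ≤ 1 - a) (h : p ^ 2 ≤ 4 * a) :
    (p ^ 3 + a ^ 2) / 20 ≤
      8 / 3 * p ^ 3 + 8 * a ^ 2 - 4 * a ^ 4 - p ^ 4 - 8 * p ^ 2 * a := by
  have hp1 : p ≤ 83 / 100 := by nlinarith
  have ha4 : a ^ 4 ≤ a ^ 2 * (1 - p) ^ 2 := by
    have : a ^ 2 ≤ (1 - p) ^ 2 := pow_le_pow_left₀ ha (by linarith) 2
    nlinarith [sq_nonneg a]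
  set A := 8 - 4 * (1 - p) ^ 2 - 1 / 20 with hA
  set C := 8 / 3 - p - 1 / 20 with hC
  have hA0 : 0 < A := by nlinarith
  have hAC : 16 * p ≤ A * C := by rw [hA, hC]; nlinarith [mul_nonneg hp hp]
  have hF : 0 ≤ A * (A * a ^ 2 - 8 * p ^ 2 * a + C * p ^ 3) := by
    have : 0 ≤ (A * C - 16 * p) * p ^ 3 := mul_nonneg (by linarith) (by positivity)
    nlinarith [sq_nonneg (A * a - 4 * p ^ 2)]
  have hF2 := nonneg_of_mul_nonneg_right hF hA0
  rw [hA, hC] at hF2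
  nlinarith

lemma slack_of_le_sq {a p : ℝ} (ha : 0 ≤ a) (hp : 0 ≤ p) (hap : p ≤ 1 - a) (h : 4 * a ≤ p ^ 2) :
    (p ^ 3 + a ^ 2) / 20 ≤ 8 / 3 * p ^ 3 - 8 * a ^ 2 - 4 * a ^ 4 - 2 * p ^ 4 := by
  have hp1 : p ≤ 1 := by linarith
  have h2 : 16 * a ^ 2 ≤ p ^ 4 := by nlinarith
  have h3 : p ^ 4 ≤ p ^ 3 := pow_le_pow_of_le_one hp hp1 (by norm_num)
  have h4 : a ^ 4 ≤ a ^ 2 / 16 := by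
    have : a ≤ 1 / 4 := by nlinarith
    nlinarith [mul_nonneg (sq_nonneg a) (by nlinarith : 0 ≤ 1 / 16 - a ^ 2)]
  nlinarith [pow_nonneg hp 3]

lemma norm_pairForm_le {p q r : ℝ} (hp : 0 < p) (hpq : p ≤ q) (hqr : q ≤ r) {X : Fin 3 → ℂ}
    (h0 : ‖X 0‖ = p ^ 2) (h1 : ‖X 1‖ = q ^ 2) (h2 : ‖X 2‖ = r ^ 2) :
    ‖pairForm X‖ ≤ 4 / 3 * (q + r) * (p ^ 3 + q ^ 3 + r ^ 3) - (q + r) ^ 4 / 12 -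
      (p ^ 3 * (q + r) / 2 + (r ^ 2 - q ^ 2) ^ 2 / 16) / 20 := by
  obtain ⟨m, hm⟩ : ∃ m, m = (q + r) / 2 := ⟨_, rfl⟩
  obtain ⟨a, ha⟩ : ∃ a, a = (r - q) / 2 := ⟨_, rfl⟩
  obtain rfl : q = m - a := by linarith
  obtain rfl : r = m + a := by linarith
  have hm0 : 0 < m := by linarith
  have ha0 : 0 ≤ a / m := div_nonneg (by linarith) hm0.le
  have hp0 : 0 ≤ p / m := by positivity
  have hap : p / m ≤ 1 - a / m := by rw [div_le_iff₀ hm0]; field_simp; linarith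
  obtain ⟨hA, hB⟩ := norm_pairForm_le_of_norms h0 h1 h2
  have e3 : p / m * m = p := div_mul_cancel₀ _ hm0.ne'
  have e4 : a / m * m = a := div_mul_cancel₀ _ hm0.ne'
  generalize p / m = p' at *
  generalize a / m = a' at *
  subst e3 e4
  rcases le_total (p' ^ 2) (4 * a') with h | h
  · have hs := slack_of_sq_le ha0 hp0 hap h
    have hs2 := mul_le_mul_of_nonneg_left hs (by positivity : 0 ≤ m ^ 4)
    refine (hB ?_).trans ?_
    · nlinarith [mul_le_mul_of_nonneg_left h (by positivity : 0 ≤ m ^ 2)]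
    · linarith
  · have hs := slack_of_le_sq ha0 hp0 hap h
    have hs2 := mul_le_mul_of_nonneg_left hs (by positivity : 0 ≤ m ^ 4)
    refine hA.trans ?_
    linarith

lemma factorial_mul_exp_le {u : ℕ} (hu : 1 ≤ u) :
    (u.factorial : ℝ) * Real.exp u ≤ Real.exp 1 * u * (u : ℝ) ^ u := by
  induction u, hu using Nat.le_induction with
  | base => simp
  | succ u hu ih =>
    have hu0 : (0 : ℝ) < u := by exact_mod_cast hu
    have h1 : ((u : ℝ) / (u + 1)) ^ (u + 1) ≤ Real.exp (-1) := by
      have h2 : (u : ℝ) / (u + 1) ≤ Real.exp (-(1 / (u + 1))) := by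
        have := Real.add_one_le_exp (-(1 / ((u : ℝ) + 1)))
        refine le_trans (le_of_eq ?_) this
        field_simp; ring
      refine (pow_le_pow_left₀ (by positivity) h2 _).trans (le_of_eq ?_)
      rw [← Real.exp_nat_mul]
      congr 1
      push_cast
      field_simp
    rw [div_pow, div_le_iff₀ (by positivity)] at h1
    have h3 : (u : ℝ) ^ (u + 1) * Real.exp 1 ≤ ((u : ℝ) + 1) ^ (u + 1) := by
      have := mul_le_mul_of_nonneg_right h1 (Real.exp_pos 1).le
      rw [mul_right_comm, ← Real.exp_add] at this
      simpa using this
    rw [Nat.factorial_succ]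
    push_cast
    rw [Real.exp_add]
    calc ((u : ℝ) + 1) * u.factorial * (Real.exp u * Real.exp 1)
        = ((u : ℝ) + 1) * Real.exp 1 * (u.factorial * Real.exp u) := by ring
      _ ≤ ((u : ℝ) + 1) * Real.exp 1 * (Real.exp 1 * u * (u : ℝ) ^ u) := by gcongr
      _ = Real.exp 1 * (u + 1) * ((u : ℝ) ^ (u + 1) * Real.exp 1) := by ring
      _ ≤ _ := by gcongr

lemma pow_self_le_classSize_mul {n : ℕ} (z : Fin n → Fin 3) (hz : ∀ c, 1 ≤ colorCount z c) :
    (n : ℝ) ^ n ≤ classSize z * (Real.exp 1 ^ 3 * n ^ 3) *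
      ∏ c, (colorCount z c : ℝ) ^ colorCount z c := by
  have h1 := Real.pow_div_factorial_le_exp (n : ℝ) n.cast_nonneg n
  rw [div_le_iff₀ (by exact_mod_cast n.factorial_pos), ← classSize_mul_prod_factorial z] at h1
  have hsum : (n : ℝ) = ∑ c, (colorCount z c : ℝ) := by exact_mod_cast (sum_colorCount z).symm
  have h2 : Real.exp n * ∏ c, ((colorCount z c).factorial : ℝ) ≤
      ∏ c, (Real.exp 1 * n * (colorCount z c : ℝ) ^ colorCount z c) := by
    conv_lhs => rw [hsum]
    rw [Real.exp_sum, ← Finset.prod_mul_distrib]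
    refine Finset.prod_le_prod (fun c _ => by positivity) fun c _ => ?_
    rw [mul_comm]
    refine (factorial_mul_exp_le (hz c)).trans ?_
    have : (colorCount z c : ℝ) ≤ n := by
      rw [hsum]
      exact Finset.single_le_sum (f := fun c => (colorCount z c : ℝ))
        (fun c _ => by positivity) (Finset.mem_univ c)
    gcongr
  have h3 : ∏ c : Fin 3, (Real.exp 1 * n * (colorCount z c : ℝ) ^ colorCount z c) =
      (Real.exp 1 ^ 3 * n ^ 3) * ∏ c, (colorCount z c : ℝ) ^ colorCount z c := by
    rw [Finset.prod_mul_distrib]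
    simp [mul_pow]
  rw [h3] at h2
  push_cast at h1
  calc (n : ℝ) ^ n ≤ _ := h1
    _ = classSize z * (Real.exp n * ∏ c, ((colorCount z c).factorial : ℝ)) := by ring
    _ ≤ classSize z * ((Real.exp 1 ^ 3 * n ^ 3) *
      ∏ c, (colorCount z c : ℝ) ^ colorCount z c) := by gcongr
    _ = _ := by ring

lemma cube_saddle_le {p q r ν M : ℝ} (hp : 0 < p) (hpq : p ≤ q) (hqr : q ≤ r) (hν : 0 < ν)
    (hsum : p ^ 3 + q ^ 3 + r ^ 3 = 2 * ν ^ 3) (hM0 : 0 ≤ M)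
    (hM : M ≤ 4 / 3 * (q + r) * (p ^ 3 + q ^ 3 + r ^ 3) - (q + r) ^ 4 / 12 -
      (p ^ 3 * (q + r) / 2 + (r ^ 2 - q ^ 2) ^ 2 / 16) / 20) :
    M ^ 3 ≤ 64 * ν ^ 12 * Real.exp
      (-(3 / 160 * p ^ 3 + 3 / 2560 * ((r ^ 3 - q ^ 3) ^ 2 / (2 * ν ^ 3))) / ν ^ 3) := by
  obtain ⟨m, hm⟩ : ∃ m, m = (q + r) / 2 := ⟨_, rfl⟩
  obtain ⟨a, ha⟩ : ∃ a, a = (r - q) / 2 := ⟨_, rfl⟩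
  obtain rfl : q = m - a := by linarith
  obtain rfl : r = m + a := by linarith
  have hm0 : 0 < m := by linarith
  have ha0 : 0 ≤ a := by linarith
  have ham : a ≤ m := by linarith
  have hpm : p ≤ m := by linarith
  have hn : p ^ 3 + 2 * m ^ 3 + 6 * m * a ^ 2 = 2 * ν ^ 3 := by rw [← hsum]; ring
  have hmν : m ≤ ν := by
    refine le_of_pow_le_pow_left₀ (n := 3) (by norm_num) hν.le ?_
    have : 0 ≤ p ^ 3 := by positivity
    have : 0 ≤ m * a ^ 2 := by positivity
    linarith
  have hνm : ν ≤ 2 * m := by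
    refine le_of_pow_le_pow_left₀ (n := 3) (by norm_num) (by positivity) ?_
    have h1 : p ^ 3 ≤ m ^ 3 := pow_le_pow_left₀ hp.le hpm 3
    have h2 : m * a ^ 2 ≤ m * m ^ 2 := by gcongr
    have h3 : 0 < m ^ 3 := by positivity
    nlinarith
  set s := (p ^ 3 * m + m ^ 2 * a ^ 2) / 20 with hs
  have hM1 : M ≤ 4 * ν ^ 4 - s := by
    have h1 : 0 ≤ (m - ν) ^ 2 * (m ^ 2 + 2 * m * ν + 3 * ν ^ 2) := by positivity
    rw [hsum] at hM
    nlinarith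
  have hM2 : M ≤ 4 * ν ^ 4 * Real.exp (-(s / (4 * ν ^ 4))) := by
    have h1 := Real.add_one_le_exp (-(s / (4 * ν ^ 4)))
    have h2 := mul_le_mul_of_nonneg_left h1 (by positivity : 0 ≤ 4 * ν ^ 4)
    refine hM1.trans (le_trans (le_of_eq ?_) h2)
    field_simp; ring
  refine (pow_le_pow_left₀ hM0 hM2 3).trans ?_
  rw [mul_pow, ← Real.exp_nat_mul]
  have h4 : (4 * ν ^ 4) ^ 3 = 64 * ν ^ 12 := by ring
  rw [h4]
  refine mul_le_mul_of_nonneg_left (Real.exp_le_exp.2 ?_) (by positivity)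
  have hE : 3 / 160 * p ^ 3 + 3 / 2560 * (((m + a) ^ 3 - (m - a) ^ 3) ^ 2 / (2 * ν ^ 3)) ≤
      3 * s / (4 * ν) := by
    have e1 : 3 / 160 * p ^ 3 ≤ 3 / 80 * (p ^ 3 * m) / ν := by
      rw [le_div_iff₀ hν]
      have : 0 ≤ p ^ 3 := by positivity
      nlinarith [mul_le_mul_of_nonneg_left hνm this]
    have e2 : 3 / 2560 * (((m + a) ^ 3 - (m - a) ^ 3) ^ 2 / (2 * ν ^ 3)) ≤
        3 / 80 * (m ^ 2 * a ^ 2) / ν := by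
      have h5 : (m + a) ^ 3 - (m - a) ^ 3 ≤ 8 * ν * (m * a) := by
        have h6 : a ^ 2 * a ≤ m ^ 2 * a := by gcongr
        have h7 : m * (m * a) ≤ ν * (m * a) := by gcongr
        nlinarith
      have h8 : 0 ≤ (m + a) ^ 3 - (m - a) ^ 3 := by
        have : (m + a) ^ 3 - (m - a) ^ 3 = 6 * m ^ 2 * a + 2 * a ^ 3 := by ring
        rw [this]; positivity
      have h9 := pow_le_pow_left₀ h8 h5 2
      rw [← mul_div_assoc, div_le_div_iff₀ (by positivity) hν]
      have := mul_le_mul_of_nonneg_right h9 hν.le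
      nlinarith
    refine (add_le_add e1 e2).trans (le_of_eq ?_)
    rw [hs]; field_simp; norm_num
  have h5 : 3 * s / (4 * ν) / ν ^ 3 = 3 * (s / (4 * ν ^ 4)) := by field_simp
  have h6 := div_le_div_of_nonneg_right hE (by positivity : 0 ≤ ν ^ 3)
  rw [h5] at h6
  rw [neg_div]
  push_cast
  linarith

lemma exists_pow_three_eq {x : ℝ} (hx : 0 < x) : ∃ p : ℝ, 0 < p ∧ p ^ 3 = x :=
  ⟨x ^ (1 / 3 : ℝ), by positivity, by
    rw [← Real.rpow_natCast, ← Real.rpow_mul hx.le]; norm_num⟩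

/-- Saddle point estimate for the mean sign of a colouring with ordered colour counts. -/
lemma classSize_mul_cube_le {k : ℕ} (z : Fin (2 * k) → Fin 3) (h0 : 1 ≤ colorCount z 0)
    (h01 : colorCount z 0 ≤ colorCount z 1) (h12 : colorCount z 1 ≤ colorCount z 2) :
    classSize z * |meanSign z| ^ 3 ≤ 2 ^ (2 * k) * (Real.exp 1 ^ 6 * (2 * k : ℝ) ^ 6) *
      Real.exp (-(3 / 160 * colorCount z 0 +
        3 / 2560 * (((colorCount z 2 : ℝ) - colorCount z 1) ^ 2 / (2 * k)))) := by
  have hsum := sum_colorCount z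
  rw [Fin.sum_univ_three] at hsum
  have hpos : ∀ c, 1 ≤ colorCount z c := by
    intro c; fin_cases c
    exacts [h0, h0.trans h01, h0.trans (h01.trans h12)]
  have hk : (0 : ℝ) < k := by
    have : 0 < k := by omega
    exact_mod_cast this
  have hcpos : ∀ c, (0 : ℝ) < colorCount z c := fun c => by exact_mod_cast hpos c
  choose f hf0 hf using fun c => exists_pow_three_eq (hcpos c)
  obtain ⟨ν, hν0, hν⟩ := exists_pow_three_eq hk
  have hmono : ∀ c c', colorCount z c ≤ colorCount z c' → f c ≤ f c' := fun c c' h =>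
    le_of_pow_le_pow_left₀ (n := 3) (by norm_num) (hf0 c').le (by
      rw [hf, hf]; exact_mod_cast h)
  have hsumR : f 0 ^ 3 + f 1 ^ 3 + f 2 ^ 3 = 2 * ν ^ 3 := by
    rw [hf, hf, hf, hν]; exact_mod_cast hsum
  obtain ⟨M, hM⟩ : ∃ M, M = 4 / 3 * (f 1 + f 2) * (f 0 ^ 3 + f 1 ^ 3 + f 2 ^ 3) -
    (f 1 + f 2) ^ 4 / 12 -
      (f 0 ^ 3 * (f 1 + f 2) / 2 + (f 2 ^ 2 - f 1 ^ 2) ^ 2 / 16) / 20 := ⟨_, rfl⟩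
  have hbound : ∀ X : Fin 3 → ℂ, (∀ c, ‖X c‖ = f c ^ 2) → ‖pairForm X‖ ≤ M := fun X hX =>
    hM ▸ norm_pairForm_le (hf0 0) (hmono 0 1 h01) (hmono 1 2 h12) (hX 0) (hX 1) (hX 2)
  have hM0 : 0 ≤ M := (norm_nonneg _).trans (hbound (fun c => (f c ^ 2 : ℝ)) fun c => by
    rw [Complex.norm_real, Real.norm_of_nonneg (by positivity)])
  have h1 := cube_saddle_le (hf0 0) (hmono 0 1 h01) (hmono 1 2 h12) hν0 hsumR hM0 hM.le
  have h2 := classSize_mul_abs_meanSign_le z (fun c => by positivity) hbound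
  have h3 := pow_self_le_classSize_mul z hpos
  set W := ∏ c, (colorCount z c : ℝ) ^ colorCount z c with hW
  have hW0 : 0 < W := Finset.prod_pos fun c _ => pow_pos (hcpos c) _
  have hWf : (∏ c, (f c ^ 2) ^ colorCount z c) ^ 3 = W ^ 2 := by
    rw [hW, ← Finset.prod_pow, ← Finset.prod_pow]
    refine Finset.prod_congr rfl fun c _ => ?_
    calc _ = ((f c ^ 3) ^ colorCount z c) ^ 2 := by ring
      _ = _ := by rw [hf]
  have hT : (0 : ℝ) < classSize z := by exact_mod_cast classSize_pos z
  rw [hf, hf, hf, hν, show ν ^ 12 = (ν ^ 3) ^ 4 by ring, hν] at h1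
  set E := 3 / 160 * (colorCount z 0 : ℝ) +
        3 / 2560 * (((colorCount z 2 : ℝ) - colorCount z 1) ^ 2 / (2 * k)) with hE
  have h4 : (M ^ k) ^ 3 ≤ 2 ^ (2 * k) * ((2 * k : ℝ) ^ (2 * k)) ^ 2 * Real.exp (-E) := by
    calc (M ^ k) ^ 3 = (M ^ 3) ^ k := by ring
      _ ≤ (64 * (k : ℝ) ^ 4 * Real.exp (-E / k)) ^ k := pow_le_pow_left₀ (by positivity) h1 k
      _ = _ := by
        rw [mul_pow, ← Real.exp_nat_mul, mul_div_cancel₀ _ hk.ne']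
        congr 1
        have h64 : (64 : ℝ) ^ k = 2 ^ (6 * k) := by rw [pow_mul]; norm_num
        rw [mul_pow, mul_pow, h64]
        ring
  have h5 := pow_le_pow_left₀ (by positivity) h2 3
  rw [mul_pow, mul_pow, hWf] at h5
  push_cast at h3
  have h6 := pow_le_pow_left₀ (by positivity) h3 2
  have h7 : (classSize z : ℝ) ^ 3 * |meanSign z| ^ 3 * W ^ 2 ≤ 2 ^ (2 * k) *
      (classSize z * (Real.exp 1 ^ 3 * (2 * k) ^ 3) * W) ^ 2 * Real.exp (-E) :=
    (h5.trans h4).trans (by gcongr)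
  have h8 : (classSize z : ℝ) ^ 2 * W ^ 2 * (classSize z * |meanSign z| ^ 3) ≤
      classSize z ^ 2 * W ^ 2 *
        (2 ^ (2 * k) * (Real.exp 1 ^ 6 * (2 * k : ℝ) ^ 6) * Real.exp (-E)) := by
    calc _ = (classSize z : ℝ) ^ 3 * |meanSign z| ^ 3 * W ^ 2 := by ring
      _ ≤ _ := h7
      _ = _ := by ring
  exact le_of_mul_le_mul_left h8 (by positivity)

lemma sum_prod_pow_colorCount {R : Type*} [CommSemiring R] (n : ℕ) (X : Fin 3 → R) :
    ∑ z : Fin n → Fin 3, ∏ c, X c ^ colorCount z c = (∑ c, X c) ^ n := by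
  simp_rw [← prod_eq_prod_pow_colorCount]
  rw [← Fintype.piFinset_univ, ← Finset.prod_univ_sum (ι := Fin n)
    (fun _ => (Finset.univ : Finset (Fin 3))) (fun _ c => X c)]
  simp

lemma sum_inv_classSize_le (n : ℕ) :
    ∑ z : Fin n → Fin 3, (1 : ℝ) / classSize z ≤ ((n : ℝ) + 1) ^ 3 := by
  rw [← Finset.sum_fiberwise_of_maps_to (s := Finset.univ)
    (t := Fintype.piFinset fun _ : Fin 3 => Finset.range (n + 1)) (g := colorCount)]
  · refine (Finset.sum_le_card_nsmul _ _ 1 fun m _ => ?_).trans (by simp)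
    rcases (Finset.univ.filter fun z : Fin n → Fin 3 => colorCount z = m).eq_empty_or_nonempty
      with h | ⟨z, hz⟩
    · rw [h]; simp
    · have hz2 := (Finset.mem_filter.1 hz).2
      have : ∀ z' ∈ Finset.univ.filter fun z : Fin n → Fin 3 => colorCount z = m,
          (1 : ℝ) / classSize z' = 1 / classSize z := fun z' hz' => by
        rw [classSize, classSize, (Finset.mem_filter.1 hz').2, hz2]
      rw [Finset.sum_congr rfl this, ← hz2, Finset.sum_const, ← classSize, nsmul_eq_mul,
        mul_one_div_cancel (by exact_mod_cast (classSize_pos z).ne')]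
  · intro z _
    have := sum_colorCount z
    simp only [Fintype.mem_piFinset, Finset.mem_range]
    intro c
    have := Finset.single_le_sum (f := colorCount z) (fun c _ => Nat.zero_le _)
      (Finset.mem_univ c)
    omega

lemma classSize_comp_perm {n : ℕ} (z : Fin n → Fin 3) (π : Equiv.Perm (Fin 3)) :
    classSize (π ∘ z) = classSize z := by
  have h1 := classSize_mul_prod_factorial z
  have h2 := classSize_mul_prod_factorial (π ∘ z)
  rw [← Equiv.prod_comp π] at h2
  simp only [colorCount_comp_perm] at h2
  exact Nat.eq_of_mul_eq_mul_right
    (Finset.prod_pos fun c _ => Nat.factorial_pos _) (h2.trans h1.symm)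

/-- The exponentially small error of the saddle point estimate. -/
def saddleError (k : ℕ) (ε : ℝ) : ℝ :=
  Real.exp 1 ^ 6 * (2 * k : ℝ) ^ 6 * Real.exp (-(3 / 81920 * (ε ^ 2 * k)))

lemma abs_meanSign_pow_three_le_of_sorted {k : ℕ} {ε : ℝ} (hε : 0 < ε) (hε1 : ε ≤ 1)
    (z : Fin (2 * k) → Fin 3) (h0 : 1 ≤ colorCount z 0)
    (h01 : colorCount z 0 ≤ colorCount z 1) (h12 : colorCount z 1 ≤ colorCount z 2) :
    |meanSign z| ^ 3 ≤ (ε ^ 3) ^ colorCount z 0 + 2 ^ (2 * k) * saddleError k ε *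
      (1 / classSize z) := by
  have hsum := sum_colorCount z
  rw [Fin.sum_univ_three] at hsum
  have hsumR : (colorCount z 0 : ℝ) + colorCount z 1 + colorCount z 2 = 2 * k := by
    exact_mod_cast hsum
  have hk : (0 : ℝ) < k := by
    have : 0 < k := by omega
    exact_mod_cast this
  have hη : 0 ≤ 2 ^ (2 * k) * saddleError k ε * (1 / classSize z) := by
    unfold saddleError; positivity
  have hd : (0 : ℝ) ≤ (colorCount z 2 : ℝ) - colorCount z 1 := by
    rw [sub_nonneg]; exact_mod_cast h12
  have hε2 : ε ^ 2 ≤ ε := by nlinarith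
  by_cases hA : 6 * (colorCount z 0 : ℝ) ≤ ε ^ 2 * k ∧
      4 * ((colorCount z 2 : ℝ) - colorCount z 1) ≤ ε * k
  · have hεk : ε ^ 2 * k ≤ ε * k := by gcongr
    have hεk2 : ε * k ≤ k := mul_le_of_le_one_left hk.le hε1
    have := abs_countSign_le_pow hε hε1 hk (colorCount z 0) k (colorCount z 1) (colorCount z 2)
      hsum (by linarith [hA.1]) (by rw [abs_of_nonneg hd]; linarith [hA.1, hA.2])
      (by linarith [hA.1])
    rw [← meanSign_eq_countSign] at this
    have h3 := pow_le_pow_left₀ (abs_nonneg _) this 3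
    rw [← pow_mul, mul_comm (colorCount z 0) 3, pow_mul] at h3
    linarith
  · have hB := classSize_mul_cube_le z h0 h01 h12
    have hT : (0 : ℝ) < classSize z := by exact_mod_cast classSize_pos z
    have hE : 3 / 81920 * (ε ^ 2 * k) ≤ 3 / 160 * (colorCount z 0 : ℝ) +
        3 / 2560 * (((colorCount z 2 : ℝ) - colorCount z 1) ^ 2 / (2 * k)) := by
      have hq : 0 ≤ ((colorCount z 2 : ℝ) - colorCount z 1) ^ 2 / (2 * k) := by positivity
      have hu : (0 : ℝ) ≤ colorCount z 0 := Nat.cast_nonneg _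
      rw [not_and_or, not_le, not_le] at hA
      rcases hA with h | h
      · linarith
      · have h2 : ε ^ 2 * k / 32 ≤ ((colorCount z 2 : ℝ) - colorCount z 1) ^ 2 / (2 * k) := by
          rw [div_le_div_iff₀ (by norm_num) (by positivity)]
          have := pow_le_pow_left₀ (by positivity) h.le 2
          nlinarith
        linarith
    have h4 : classSize z * |meanSign z| ^ 3 ≤ 2 ^ (2 * k) * saddleError k ε := by
      refine hB.trans (le_trans (mul_le_mul_of_nonneg_left
        (Real.exp_le_exp.2 (neg_le_neg hE)) (by positivity)) (le_of_eq ?_))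
      rw [saddleError]; ring
    have h5 : |meanSign z| ^ 3 ≤ 2 ^ (2 * k) * saddleError k ε * (1 / classSize z) := by
      rw [mul_one_div, le_div_iff₀ hT, mul_comm]
      exact h4
    have : 0 ≤ (ε ^ 3) ^ colorCount z 0 := by positivity
    linarith

lemma abs_meanSign_pow_three_le {k : ℕ} {ε : ℝ} (hε : 0 < ε) (hε1 : ε ≤ 1)
    (z : Fin (2 * k) → Fin 3) (hz : ∀ c, colorCount z c ≠ 0) :
    |meanSign z| ^ 3 ≤ ∑ c, (ε ^ 3) ^ colorCount z c + 2 ^ (2 * k) * saddleError k ε *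
      (1 / classSize z) := by
  set s : Equiv.Perm (Fin 3) := Tuple.sort (colorCount z)
  have hs : Monotone (colorCount z ∘ s) := Tuple.monotone_sort _
  have hc : ∀ c, colorCount (s.symm ∘ z) c = colorCount z (s c) := fun c => by
    simpa using colorCount_comp_perm z s.symm (s c)
  have h := abs_meanSign_pow_three_le_of_sorted hε hε1 (s.symm ∘ z)
    (by rw [hc]; exact Nat.one_le_iff_ne_zero.2 (hz _))
    (by rw [hc, hc]; exact hs (by decide)) (by rw [hc, hc]; exact hs (by decide))
  rw [abs_meanSign_comp_perm, classSize_comp_perm, hc] at h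
  refine h.trans (add_le_add_left ?_ _)
  exact Finset.single_le_sum (f := fun c => (ε ^ 3) ^ colorCount z c)
    (fun c _ => by positivity) (Finset.mem_univ _)

lemma abs_meanSign_pow_sub_le {k d : ℕ} (hd : 3 ≤ d) {ε : ℝ} (hε : 0 < ε) (hε1 : ε ≤ 1)
    (z : Fin (2 * k) → Fin 3) :
    |meanSign z ^ d - (0 ^ colorCount z 0 + 0 ^ colorCount z 1 +
        ((-1) ^ d) ^ colorCount z 0 * 0 ^ colorCount z 2)| ≤
      ∑ c, ((ε ^ 3) ^ colorCount z c - 0 ^ colorCount z c) +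
        2 ^ (2 * k) * saddleError k ε * (1 / classSize z) +
        4 * (0 ^ colorCount z 0 * 0 ^ colorCount z 1 + 0 ^ colorCount z 0 * 0 ^ colorCount z 2 +
          0 ^ colorCount z 1 * 0 ^ colorCount z 2) := by
  have hη : 0 ≤ 2 ^ (2 * k) * saddleError k ε * (1 / classSize z) := by
    unfold saddleError; positivity
  have hδ : ∀ m : ℕ, (0 : ℝ) ≤ (ε ^ 3) ^ m - 0 ^ m := fun m =>
    sub_nonneg.2 (pow_le_pow_left₀ le_rfl (by positivity) m)
  have hS : 0 ≤ ∑ c, ((ε ^ 3) ^ colorCount z c - 0 ^ colorCount z c) :=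
    Finset.sum_nonneg fun c _ => hδ _
  have hG : |meanSign z ^ d| ≤ 1 := by
    rw [abs_pow]; exact pow_le_one₀ (abs_nonneg _) (abs_meanSign_le z)
  have hs : |((-1 : ℝ) ^ d) ^ colorCount z 0| = 1 := by simp
  have hcom : ((-1 : ℝ) ^ colorCount z 0) ^ d = ((-1) ^ d) ^ colorCount z 0 := by
    rw [← pow_mul, mul_comm, pow_mul]
  obtain ⟨hG1, hG2⟩ := abs_le.1 hG
  obtain ⟨hs1, hs2⟩ := abs_le.1 hs.le
  have he := even_two_mul k
  by_cases h0 : colorCount z 0 = 0 <;> by_cases h1 : colorCount z 1 = 0 <;>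
    by_cases h2 : colorCount z 2 = 0
  · simp only [h0, h1, h2, pow_zero] at *
    rw [abs_le]; constructor <;> linarith
  · simp only [h0, h1, pow_zero, zero_pow h2] at *
    rw [abs_le]; constructor <;> linarith
  · simp only [h0, h2, pow_zero, zero_pow h1] at *
    rw [abs_le]; constructor <;> linarith
  · rw [meanSign_of_missing_zero he h0]
    simp only [h0, zero_pow h1, zero_pow h2, pow_zero, one_pow]
    simp only [add_zero, mul_zero, sub_self, abs_zero]
    linarith
  · simp only [h1, h2, pow_zero, zero_pow h0] at *
    rw [abs_le]; constructor <;> linarith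
  · rw [meanSign_of_missing_one he h1]
    simp only [h1, zero_pow h0, zero_pow h2, pow_zero, one_pow]
    simp only [add_zero, zero_add, mul_zero, zero_mul, sub_self, abs_zero]
    linarith
  · rw [meanSign_of_missing_two he h2, hcom]
    simp only [h2, zero_pow h0, zero_pow h1, pow_zero]
    simp only [add_zero, zero_add, mul_zero, mul_one, sub_self, abs_zero]
    linarith
  · have h := abs_meanSign_pow_three_le hε hε1 z (by intro c; fin_cases c; exacts [h0, h1, h2])
    have h3 : |meanSign z| ^ d ≤ |meanSign z| ^ 3 :=
      pow_le_pow_of_le_one (abs_nonneg _) (abs_meanSign_le z) hd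
    simp only [Fin.sum_univ_three, zero_pow h0, zero_pow h1, zero_pow h2] at *
    simp only [add_zero, mul_zero, sub_zero, abs_pow]
    linarith

lemma abs_matchingAvgM2_sub_le {k d : ℕ} (hd : 3 ≤ d) {ε : ℝ} (hε : 0 < ε) (hε1 : ε ≤ 1) :
    |matchingAvgM2 (2 * k) d - (2 + (((-1) ^ d + 1) / 2) ^ (2 * k))| ≤
      3 * ((1 + ε ^ 3 / 2) ^ (2 * k) - 1) + saddleError k ε * ((2 * k : ℝ) + 1) ^ 3 +
        12 / 2 ^ (2 * k) := by
  have h2 : (0 : ℝ) < 2 ^ (2 * k) := by positivity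
  have hsum := Finset.sum_le_sum fun (z : Fin (2 * k) → Fin 3) (_ : z ∈ Finset.univ) =>
    abs_meanSign_pow_sub_le hd hε hε1 z
  have hsum := (Finset.abs_sum_le_sum_abs _ _).trans hsum
  have key : ∀ x y w : ℝ, ∑ z : Fin (2 * k) → Fin 3,
      x ^ colorCount z 0 * y ^ colorCount z 1 * w ^ colorCount z 2 = (x + y + w) ^ (2 * k) := by
    intro x y w
    simpa [Fin.prod_univ_three, Fin.sum_univ_three] using
      sum_prod_pow_colorCount (2 * k) ![x, y, w]
  have k0 : ∀ x : ℝ, ∑ z : Fin (2 * k) → Fin 3, x ^ colorCount z 0 = (x + 1 + 1) ^ (2 * k) := by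
    intro x; simpa using key x 1 1
  have k1 : ∀ x : ℝ, ∑ z : Fin (2 * k) → Fin 3, x ^ colorCount z 1 = (1 + x + 1) ^ (2 * k) := by
    intro x; simpa using key 1 x 1
  have k2 : ∀ x : ℝ, ∑ z : Fin (2 * k) → Fin 3, x ^ colorCount z 2 = (1 + 1 + x) ^ (2 * k) := by
    intro x; simpa using key 1 1 x
  have k01 : ∑ z : Fin (2 * k) → Fin 3, (0 : ℝ) ^ colorCount z 0 * 0 ^ colorCount z 1 = 1 := by
    simpa using key 0 0 1
  have k12 : ∑ z : Fin (2 * k) → Fin 3, (0 : ℝ) ^ colorCount z 1 * 0 ^ colorCount z 2 = 1 := by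
    simpa using key 1 0 0
  have k02 : ∀ x : ℝ, ∑ z : Fin (2 * k) → Fin 3, x ^ colorCount z 0 * 0 ^ colorCount z 2 =
      (x + 1) ^ (2 * k) := by
    intro x; simpa using key x 1 0
  simp only [Finset.sum_sub_distrib, Finset.sum_add_distrib, Fin.sum_univ_three,
    ← Finset.mul_sum, k0, k1, k2, k01, k02, k12] at hsum
  rw [matchingAvgM2_eq]
  have hinv := sum_inv_classSize_le (2 * k)
  push_cast at hinv
  have hη : 0 ≤ 2 ^ (2 * k) * saddleError k ε := by
    unfold saddleError; positivity
  have hinv2 := mul_le_mul_of_nonneg_left hinv hη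
  rw [← mul_le_mul_iff_right₀ h2]
  have e1 : 2 ^ (2 * k) * |1 / 2 ^ (2 * k) * ∑ z : Fin (2 * k) → Fin 3, meanSign z ^ d -
      (2 + (((-1) ^ d + 1) / 2) ^ (2 * k))| = |∑ z : Fin (2 * k) → Fin 3, meanSign z ^ d -
        ((0 + 1 + 1) ^ (2 * k) + (1 + 0 + 1) ^ (2 * k) + ((-1) ^ d + 1) ^ (2 * k))| := by
    rw [← abs_of_pos h2, ← abs_mul, abs_of_pos h2]
    congr 1
    rw [div_pow]
    field_simp
    norm_num
    ring
  have e2 : (ε ^ 3 + 1 + 1) ^ (2 * k) = 2 ^ (2 * k) * (1 + ε ^ 3 / 2) ^ (2 * k) := by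
    rw [← mul_pow]; ring
  have e3 : (1 + ε ^ 3 + 1) ^ (2 * k) = 2 ^ (2 * k) * (1 + ε ^ 3 / 2) ^ (2 * k) := by
    rw [← mul_pow]; ring
  have e4 : (1 + 1 + ε ^ 3) ^ (2 * k) = 2 ^ (2 * k) * (1 + ε ^ 3 / 2) ^ (2 * k) := by
    rw [← mul_pow]; ring
  rw [e1]
  refine hsum.trans ?_
  have e5 : 2 ^ (2 * k) * (12 / 2 ^ (2 * k) : ℝ) = 12 := by field_simp
  rw [e2, e3, e4, mul_add (2 ^ (2 * k) : ℝ), mul_add (2 ^ (2 * k) : ℝ), e5]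
  norm_num at hinv2 ⊢
  linarith

/-- The distance of `matchingAvgM2 (2 * k) d` from its main term is at most `matchingErr t`, where
`t = k^(1/5)`. -/
def matchingErr (t : ℝ) : ℝ :=
  3 * (Real.exp t⁻¹ - 1) +
    1728 * Real.exp 1 ^ 6 * (t ^ 45 * Real.exp (-((3 / 81920) * t))) + 12 / (t ^ 5 + 1)

lemma tendsto_matchingErr : Filter.Tendsto matchingErr Filter.atTop (nhds 0) := by
  have h1 : Filter.Tendsto (fun t : ℝ => Real.exp t⁻¹ - 1) Filter.atTop (nhds 0) := by
    simpa using ((Real.continuous_exp.tendsto 0).comp tendsto_inv_atTop_zero).sub_const 1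
  have h2 : Filter.Tendsto (fun t : ℝ => t ^ 45 * Real.exp (-((3 / 81920) * t)))
      Filter.atTop (nhds 0) := by
    have := tendsto_rpow_mul_exp_neg_mul_atTop_nhds_zero 45 (3 / 81920) (by norm_num)
    refine this.congr fun t => ?_
    rw [neg_mul]
    norm_cast
  have h3 : Filter.Tendsto (fun t : ℝ => 12 / (t ^ 5 + 1)) Filter.atTop (nhds 0) :=
    (Filter.tendsto_atTop_add_const_right _ 1
      (Filter.tendsto_pow_atTop (by norm_num))).const_div_atTop 12
  have h := ((h1.const_mul 3).add (h2.const_mul (1728 * Real.exp 1 ^ 6))).add h3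
  rwa [mul_zero, mul_zero, add_zero, add_zero] at h

lemma abs_matchingAvgM2_sub_le_matchingErr {k d : ℕ} (hk : 1 ≤ k) (hd : 3 ≤ d) :
    |matchingAvgM2 (2 * k) d - (2 + (((-1) ^ d + 1) / 2) ^ (2 * k))| ≤
      matchingErr ((k : ℝ) ^ (1 / 5 : ℝ)) := by
  have hk1 : (1 : ℝ) ≤ k := by exact_mod_cast hk
  set t : ℝ := (k : ℝ) ^ (1 / 5 : ℝ)
  have ht1 : 1 ≤ t := Real.one_le_rpow hk1 (by norm_num)
  have ht5 : t ^ 5 = k := by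
    rw [← Real.rpow_natCast, ← Real.rpow_mul (by positivity)]; norm_num
  have ht : 0 < t := by positivity
  have hε1 : (t ^ 2)⁻¹ ≤ 1 := inv_le_one_of_one_le₀ (one_le_pow₀ ht1)
  refine (abs_matchingAvgM2_sub_le hd (by positivity) hε1).trans ?_
  have a1 : (1 + ((t ^ 2)⁻¹) ^ 3 / 2) ^ (2 * k) ≤ Real.exp t⁻¹ := by
    have h := pow_le_pow_left₀ (by positivity) (Real.add_one_le_exp (((t ^ 2)⁻¹) ^ 3 / 2)) (2 * k)
    rw [← Real.exp_nat_mul, add_comm] at h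
    refine h.trans (le_of_eq (congrArg Real.exp ?_))
    push_cast
    rw [← ht5]
    field_simp
  have a2 : saddleError k (t ^ 2)⁻¹ * ((2 * k : ℝ) + 1) ^ 3 ≤
      1728 * Real.exp 1 ^ 6 * (t ^ 45 * Real.exp (-((3 / 81920) * t))) := by
    have e : ((t ^ 2)⁻¹) ^ 2 * (k : ℝ) = t := by rw [← ht5]; field_simp
    have c : ((2 * k : ℝ) + 1) ^ 3 ≤ (3 * k) ^ 3 := by gcongr; linarith
    rw [saddleError, e]
    refine (mul_le_mul_of_nonneg_left c (by positivity)).trans (le_of_eq ?_)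
    rw [← ht5]; ring
  have a3 : (12 : ℝ) / 2 ^ (2 * k) ≤ 12 / (t ^ 5 + 1) := by
    rw [ht5]
    gcongr
    have h : k + 1 ≤ 2 ^ (2 * k) :=
      (Nat.lt_two_pow_self).trans_le (Nat.pow_le_pow_right (by norm_num) (by omega))
    exact_mod_cast h
  rw [matchingErr]
  linarith

lemma tendsto_matchingAvgM2_sub {d : ℕ → ℕ} (hd : ∀ n, 3 ≤ d n) :
    Filter.Tendsto (fun n => matchingAvgM2 n (d n) - (2 + (((-1) ^ d n + 1) / 2) ^ n))
      (Filter.atTop ⊓ Filter.principal {n | Even n}) (nhds 0) := by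
  have hlim : Filter.Tendsto (fun n : ℕ => matchingErr (((n / 2 : ℕ) : ℝ) ^ (1 / 5 : ℝ)))
      Filter.atTop (nhds 0) :=
    tendsto_matchingErr.comp ((tendsto_rpow_atTop (by norm_num)).comp
      (tendsto_natCast_atTop_atTop.comp (Nat.tendsto_div_const_atTop (by norm_num))))
  refine squeeze_zero_norm' ?_ (hlim.mono_left inf_le_left)
  rw [Filter.eventually_inf_principal]
  filter_upwards [Filter.eventually_ge_atTop 2] with n hn he
  obtain ⟨k, rfl⟩ := even_iff_exists_two_mul.1 he
  rw [Nat.mul_div_cancel_left _ (by norm_num), Real.norm_eq_abs]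
  exact abs_matchingAvgM2_sub_le_matchingErr (by omega) (hd _)

/-- anticoncentration of the random matching model. For `d_n ≥ 3` with
`d_n/√n → 0`, along even `n` the average second moment tends to `2` if all `d_n` are
odd and to `3` if all `d_n` are even. -/
theorem stmt_4 (d : ℕ → ℕ) (hd3 : ∀ n, 3 ≤ d n)
    (hdsub : Filter.Tendsto (fun n => (d n : ℝ) / Real.sqrt n) Filter.atTop (nhds 0)) :
    ((∀ n, Odd (d n)) →
      Filter.Tendsto (fun n => matchingAvgM2 n (d n))
        (Filter.atTop ⊓ Filter.principal {n | Even n}) (nhds 2)) ∧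
    ((∀ n, Even (d n)) →
      Filter.Tendsto (fun n => matchingAvgM2 n (d n))
        (Filter.atTop ⊓ Filter.principal {n | Even n}) (nhds 3)) := by
  have h := tendsto_matchingAvgM2_sub hd3
  constructor
  · intro ho
    have h' := h.add_const 2
    rw [zero_add] at h'
    refine h'.congr' (Filter.Eventually.filter_mono inf_le_left ?_)
    filter_upwards [Filter.eventually_ge_atTop 1] with n hn
    rw [(ho n).neg_one_pow, neg_add_cancel, zero_div, zero_pow (by omega)]
    ring
  · intro hev
    have h' := h.add_const 3
    rw [zero_add] at h'
    refine h'.congr fun n => ?_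
    rw [(hev n).neg_one_pow, one_add_one_eq_two, div_self two_ne_zero, one_pow]
    ring
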